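/- arXiv:2402.11426 — 2 statements merged into one kernel-verified Lean document; each statement's English description precedes it below -/
import Mathlib

section
/- There exists a sufficiently large constant c such that the following holds. Let u, ℓ, m be positive integers and let A₁, …, A_ℓ be subsets of [0, u], each of size at least m. If ℓ · (m − 1) ≥ c · u, then the sumset A₁ + ⋯ + A_ℓ contains an arithmetic progression of length at least u. -/
open Pointwise Finset

namespace SumAP

section grp
variable {G : Type*} [AddCommGroup G] [DecidableEq G]

/-- Number of elements of the translate `h + T` outside `T`. -/
def dd (T : Finset G) (h : G) : ℕ := #((h +ᵥ T) \ T)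

lemma dd_add_inter (T : Finset G) (h : G) : dd T h + #(T ∩ (h +ᵥ T)) = #T := by
  unfold dd
  rw [inter_comm, card_sdiff_add_card_inter, card_vadd_finset]

lemma dd_zero (T : Finset G) : dd T 0 = 0 := by
  simp [dd]

lemma dd_add (T : Finset G) (x y : G) : dd T (x + y) ≤ dd T x + dd T y := by
  unfold dd
  have h1 : ((x + y) +ᵥ T) \ T ⊆ ((x +ᵥ T) \ T) ∪ (x +ᵥ ((y +ᵥ T) \ T)) := by
    intro z hz
    rw [vadd_finset_sdiff, ← add_vadd]
    simp only [mem_union, mem_sdiff] at *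
    tauto
  calc _ ≤ _ := card_le_card h1
    _ ≤ _ := card_union_le _ _
    _ = _ := by rw [card_vadd_finset]

lemma dd_neg (T : Finset G) (x : G) : dd T (-x) = dd T x := by
  have h1 := dd_add_inter T x
  have h2 := dd_add_inter T (-x)
  have h3 : T ∩ (-x +ᵥ T) = -x +ᵥ (T ∩ (x +ᵥ T)) := by
    rw [vadd_finset_inter, ← add_vadd, inter_comm]; simp
  rw [h3, card_vadd_finset] at h2
  omega

/-- Iterated sumset. -/
def Bl (B : Finset G) : ℕ → Finset G
  | 0 => {0}
  | k + 1 => Bl B k + B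

lemma Bl_mono (B : Finset G) (h0 : (0 : G) ∈ B) {j k : ℕ} (h : j ≤ k) : Bl B j ⊆ Bl B k := by
  induction h with
  | refl => rfl
  | step _ ih =>
    intro x hx
    have := add_mem_add (ih hx) h0
    simpa [Bl] using this

lemma Bl_dd (T B : Finset G) (D : ℕ) (hB : ∀ x ∈ B, 96 * dd T x ≤ D) (r : ℕ) :
    ∀ h ∈ Bl B r, 96 * dd T h ≤ r * D := by
  induction r with
  | zero => intro h hh; simp [Bl] at hh; simp [hh, dd_zero]
  | succ r ih =>
    intro h hh
    simp only [Bl, mem_add] at hh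
    obtain ⟨y, hy, z, hz, rfl⟩ := hh
    have := dd_add T y z
    have := ih y hy
    have := hB z hz
    nlinarith

lemma Bl_growth (B : Finset G) (h0 : (0 : G) ∈ B) (hneg : ∀ x ∈ B, -x ∈ B) (k : ℕ) :
    k * #B ≤ #(Bl B (3 * k)) ∨ ∀ h ∈ AddSubgroup.closure (B : Set G), h ∈ Bl B (3 * k) := by
  induction k with
  | zero => left; simp
  | succ k ih =>
    rcases ih with ih | ih
    · by_cases hst : Bl B (3 * k + 2) ⊆ Bl B (3 * k + 1)
      · right
        intro h hh
        refine Bl_mono B h0 (show 3 * k + 1 ≤ 3 * (k + 1) by omega) ?_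
        have key : ∀ x ∈ Bl B (3 * k + 1), ∀ b ∈ B, x + b ∈ Bl B (3 * k + 1) :=
          fun x hx b hb => hst (add_mem_add hx hb)
        have z0 : (0 : G) ∈ Bl B (3 * k + 1) :=
          Bl_mono B h0 (Nat.zero_le _) (by simp [Bl])
        have : ∀ x ∈ Bl B (3 * k + 1), x + h ∈ Bl B (3 * k + 1) := by
          induction hh using AddSubgroup.closure_induction with
          | mem b hb => intro x hx; exact key x hx b hb
          | zero => intro x hx; simpa using hx
          | add y z _ _ hy hz => intro x hx; rw [← add_assoc]; exact hz _ (hy _ hx)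
          | neg y _ hy =>
            intro x hx
            have himg : (Bl B (3 * k + 1)).image (· + y) = Bl B (3 * k + 1) := by
              apply eq_of_subset_of_card_le
              · intro w hw
                simp only [mem_image] at hw
                obtain ⟨v, hv, rfl⟩ := hw
                exact hy v hv
              · rw [card_image_of_injective _ (add_left_injective y)]
            rw [← himg] at hx
            simp only [mem_image] at hx
            obtain ⟨v, hv, rfl⟩ := hx
            simpa using hv
        simpa using this 0 z0
      · left
        obtain ⟨y, hy, hy'⟩ := Finset.not_subset.mp hst
        have h1 : (y +ᵥ B) ⊆ Bl B (3 * (k + 1)) := by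
          intro w hw
          obtain ⟨b, hb, rfl⟩ := mem_vadd_finset.mp hw
          exact add_mem_add hy hb
        have h2 : Bl B (3 * k) ⊆ Bl B (3 * (k + 1)) := Bl_mono B h0 (by omega)
        have h3 : Disjoint (Bl B (3 * k)) (y +ᵥ B) := by
          rw [Finset.disjoint_left]
          intro w hw hw'
          obtain ⟨b, hb, rfl⟩ := mem_vadd_finset.mp hw'
          apply hy'
          have := add_mem_add hw (hneg b hb)
          simpa [Bl] using this
        have h4 := card_le_card (union_subset h2 h1)
        rw [card_union_of_disjoint h3, card_vadd_finset] at h4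
        linarith
    · right
      intro h hh
      exact Bl_mono B h0 (by omega) (ih h hh)

lemma sum_inter_le (T X : Finset G) : ∑ h ∈ X, #(T ∩ (h +ᵥ T)) ≤ #T * #T := by
  have : ∀ h, #(T ∩ (h +ᵥ T)) = #((T ×ˢ T).filter (fun p => p.1 - p.2 = h)) := by
    intro h
    apply card_bij (fun x _ => (x, x - h))
    · intro x hx
      simp only [mem_inter, mem_vadd_finset] at hx
      obtain ⟨hx, y, hy, rfl⟩ := hx
      simp_all
    · intro x _ y _ h; simpa using (Prod.ext_iff.mp h).1
    · rintro ⟨x, y⟩ hp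
      simp only [mem_filter, mem_product] at hp
      obtain ⟨⟨hx, hy⟩, rfl⟩ := hp
      refine ⟨x, ?_, by simp⟩
      simp only [mem_inter, mem_vadd_finset]
      exact ⟨hx, y, hy, by simp⟩
  simp_rw [this]
  rw [← card_product]
  rw [← card_biUnion]
  · apply card_le_card
    intro p hp
    simp only [mem_biUnion, mem_filter] at hp
    obtain ⟨_, _, h, _⟩ := hp
    exact h
  · intro x _ y _ hxy
    rw [Function.onFun, Finset.disjoint_left]
    intro p hp hp'
    simp only [mem_filter] at hp hp'
    exact hxy (hp.2.symm.trans hp'.2)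

/-- `T` is nearly `H`-periodic. -/
def Fini (T : Finset G) (H : AddSubgroup G) : Prop :=
  T.Nonempty ∧ ∀ h ∈ H, 3 * #T ≤ 4 * #(T ∩ (h +ᵥ T))

lemma step (T S : Finset G) (hT : T.Nonempty) (hS : S.Nonempty) :
    Fini T (AddSubgroup.closure (S : Set G)) ∨
      ∃ x ∈ S, min (#T) (#S) < 96 * dd T x := by
  by_contra! hcon
  obtain ⟨h1, h2⟩ := hcon
  apply h1
  refine ⟨hT, ?_⟩
  set B : Finset G := insert 0 (S ∪ -S) with hB
  have hτ : 0 < #T := hT.card_pos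
  have hs : 0 < #S := hS.card_pos
  have hBS : #S ≤ #B := card_le_card (by intro x hx; simp [hB, hx])
  have h0 : (0 : G) ∈ B := by simp [hB]
  have hneg : ∀ x ∈ B, -x ∈ B := by
    intro x hx
    simp only [hB, mem_insert, mem_union, mem_neg'] at *
    simp only [neg_eq_zero, neg_neg]
    tauto
  have hBd : ∀ x ∈ B, 96 * dd T x ≤ min (#T) (#S) := by
    intro x hx
    simp only [hB, mem_insert, mem_union, mem_neg'] at hx
    rcases hx with rfl | hx | hx
    · simp [dd_zero]
    · exact h2 x hx
    · rw [← dd_neg]; exact h2 _ hx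
  obtain ⟨k, hk1, hk2⟩ : ∃ k, k * min (#T) (#S) ≤ 8 * #T ∧ 7 * #T ≤ k * #S := by
    rcases le_total (#T) (#S) with h | h
    · refine ⟨8, ?_, ?_⟩
      · rw [min_eq_left h]
      · omega
    · refine ⟨8 * #T / #S, ?_, ?_⟩
      · rw [min_eq_right h]; exact Nat.div_mul_le_self _ _
      · have := Nat.lt_div_mul_add hs (a := 8 * #T)
        omega
  have hdd : ∀ h ∈ Bl B (3 * k), 3 * #T ≤ 4 * #(T ∩ (h +ᵥ T)) := by
    intro h hh
    have a1 := Bl_dd T B _ hBd (3 * k) h hh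
    have a2 := dd_add_inter T h
    have : 3 * k * min (#T) (#S) = 3 * (k * min (#T) (#S)) := by ring
    omega
  rcases Bl_growth B h0 hneg k with h | h
  · exfalso
    have a1 := sum_inter_le T (Bl B (3 * k))
    have a2 : #(Bl B (3 * k)) * (3 * #T) ≤ 4 * ∑ h ∈ Bl B (3 * k), #(T ∩ (h +ᵥ T)) := by
      rw [Finset.mul_sum, ← smul_eq_mul, ← Finset.sum_const]
      exact Finset.sum_le_sum hdd
    have a3 : k * #S ≤ k * #B := Nat.mul_le_mul_left _ hBS
    have a4 : 7 * #T ≤ #(Bl B (3 * k)) := by omega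
    nlinarith
  · intro x hx
    apply hdd
    apply h
    refine AddSubgroup.closure_mono ?_ hx
    intro y hy
    simp only [hB, coe_insert, coe_union]
    right; left; exact hy

lemma Fini.mono {T : Finset G} {H H' : AddSubgroup G} (h : Fini T H) (hH : H' ≤ H) :
    Fini T H' := ⟨h.1, fun x hx => h.2 x (hH hx)⟩

lemma Fini.coset [Fintype G] {T : Finset G} {H : AddSubgroup G} (h : Fini T H)
    (F : Finset G) (hF : ∀ x, x ∈ F ↔ x ∈ H) :
    ∃ y, #F < 2 * #(T.filter (fun x => x - y ∈ F)) := by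
  by_contra! hcon
  have hT := h.1.card_pos
  have hFp : 0 < #F := card_pos.mpr ⟨0, (hF 0).2 H.zero_mem⟩
  have key : ∑ h ∈ F, #(T ∩ (h +ᵥ T)) = ∑ y ∈ T, #(T.filter (fun x => x - y ∈ F)) := by
    have e1 : ∀ h, #(T ∩ (h +ᵥ T)) = ∑ y ∈ T, if h + y ∈ T then 1 else 0 := by
      intro h
      rw [← card_filter]
      symm
      apply card_bij (fun x _ => h + x)
      · intro x hx
        simp only [mem_filter] at hx
        simp only [mem_inter, mem_vadd_finset]
        exact ⟨hx.2, x, hx.1, rfl⟩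
      · intro x _ y _ hh; simpa using hh
      · intro x hx
        simp only [mem_inter, mem_vadd_finset] at hx
        obtain ⟨hx, y, hy, rfl⟩ := hx
        exact ⟨y, by simp only [mem_filter]; exact ⟨hy, hx⟩, rfl⟩
    simp_rw [e1]
    rw [Finset.sum_comm]
    refine Finset.sum_congr rfl fun y _ => ?_
    rw [← card_filter]
    apply card_bij (fun x _ => x + y)
    · intro x hx
      simp only [mem_filter] at hx ⊢
      exact ⟨hx.2, by simpa using hx.1⟩
    · intro x _ z _ hh; simpa using hh
    · intro x hx
      simp only [mem_filter] at hx
      exact ⟨x - y, by simp only [mem_filter]; exact ⟨hx.2, by simpa using hx.1⟩, by simp⟩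
  have a1 : #F * (3 * #T) ≤ 4 * ∑ h ∈ F, #(T ∩ (h +ᵥ T)) := by
    rw [Finset.mul_sum, ← smul_eq_mul, ← Finset.sum_const]
    exact Finset.sum_le_sum fun x hx => h.2 x ((hF x).1 hx)
  have a2 : 2 * ∑ y ∈ T, #(T.filter (fun x => x - y ∈ F)) ≤ #T * #F := by
    rw [Finset.mul_sum, ← smul_eq_mul, ← Finset.sum_const]
    exact Finset.sum_le_sum fun y _ => hcon y
  rw [key] at a1
  nlinarith [Nat.mul_pos hT hFp]

lemma Fini.add [Fintype G] {T₁ T₂ : Finset G} {H : AddSubgroup G} (h₁ : Fini T₁ H)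
    (h₂ : Fini T₂ H) : ∃ z, ∀ h ∈ H, z + h ∈ T₁ + T₂ := by
  classical
  obtain ⟨F, hF⟩ : ∃ F : Finset G, ∀ x, x ∈ F ↔ x ∈ H := ⟨univ.filter (· ∈ H), by simp⟩
  obtain ⟨y₁, hy₁⟩ := h₁.coset F hF
  obtain ⟨y₂, hy₂⟩ := h₂.coset F hF
  refine ⟨y₁ + y₂, fun h hh => ?_⟩
  set X := (T₁.filter (fun x => x - y₁ ∈ F)).image (fun x => x - y₁) with hX
  set Y := (T₂.filter (fun x => x - y₂ ∈ F)).image (fun x => h - (x - y₂)) with hY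
  have hXc : #X = #(T₁.filter (fun x => x - y₁ ∈ F)) :=
    card_image_of_injective _ (sub_left_injective)
  have hYc : #Y = #(T₂.filter (fun x => x - y₂ ∈ F)) :=
    card_image_of_injective _ (fun a b hab => by simpa using hab)
  have hXF : X ⊆ F := by
    intro w hw
    simp only [hX, mem_image, mem_filter] at hw
    obtain ⟨x, ⟨_, hx⟩, rfl⟩ := hw
    exact hx
  have hYF : Y ⊆ F := by
    intro w hw
    simp only [hY, mem_image, mem_filter] at hw
    obtain ⟨x, ⟨_, hx⟩, rfl⟩ := hw
    rw [hF] at *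
    exact H.sub_mem hh hx
  have hne : ¬ Disjoint X Y := by
    intro hd
    have := card_le_card (union_subset hXF hYF)
    rw [card_union_of_disjoint hd] at this
    omega
  rw [Finset.not_disjoint_iff] at hne
  obtain ⟨w, hw1, hw2⟩ := hne
  simp only [hX, hY, mem_image, mem_filter] at hw1 hw2
  obtain ⟨a, ⟨ha, _⟩, rfl⟩ := hw1
  obtain ⟨b, ⟨hb, _⟩, hab⟩ := hw2
  have : y₁ + y₂ + h = a + b := by
    have : h = (a - y₁) + (b - y₂) := by rw [← hab]; abel
    rw [this]; abel
  rw [this]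
  exact add_mem_add ha hb

end grp

section proc
variable {ι : Type*} [DecidableEq ι]

/-- Sumset over an index set. -/
def Sm (A : ι → Finset ℕ) (J : Finset ι) : Finset ℕ := ∑ i ∈ J, A i

lemma Sm_union (A : ι → Finset ℕ) {J J' : Finset ι} (h : Disjoint J J') :
    Sm A (J ∪ J') = Sm A J + Sm A J' := Finset.sum_union h

lemma Sm_insert (A : ι → Finset ℕ) {J : Finset ι} {i : ι} (h : i ∉ J) :
    Sm A (insert i J) = A i + Sm A J := Finset.sum_insert h

lemma Sm_zero (A : ι → Finset ℕ) (h0 : ∀ i, 0 ∈ A i) (J : Finset ι) : 0 ∈ Sm A J := by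
  induction J using Finset.induction_on with
  | empty => simp [Sm]
  | insert i J hi ih =>
    rw [Sm_insert A hi]
    simpa using add_mem_add (h0 i) ih

lemma Sm_mono (A : ι → Finset ℕ) (h0 : ∀ i, 0 ∈ A i) {J J' : Finset ι} (h : J ⊆ J') :
    Sm A J ⊆ Sm A J' := by
  intro x hx
  have : J' = J ∪ (J' \ J) := by rw [union_sdiff_of_subset h]
  rw [this, Sm_union A disjoint_sdiff]
  simpa using add_mem_add hx (Sm_zero A h0 (J' \ J))

lemma Sm_le (A : ι → Finset ℕ) (u : ℕ) (J : Finset ι) (hA : ∀ i ∈ J, ∀ x ∈ A i, x ≤ u) :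
    ∀ x ∈ Sm A J, x ≤ #J * u := by
  induction J using Finset.induction_on with
  | empty => simp [Sm]
  | insert i J hi ih =>
    rw [Sm_insert A hi, card_insert_of_notMem hi]
    intro x hx
    obtain ⟨y, hy, z, hz, rfl⟩ := mem_add.mp hx
    have := hA i (mem_insert_self _ _) y hy
    have := ih (fun j hj => hA j (mem_insert_of_mem hj)) z hz
    linarith

/-- Reduction modulo `n`. -/
def im (n : ℕ) (X : Finset ℕ) : Finset (ZMod n) := X.image (fun x : ℕ => (x : ZMod n))

lemma im_add (n : ℕ) (X Y : Finset ℕ) : im n (X + Y) = im n X + im n Y := by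
  unfold im
  exact Finset.image_add (Nat.castAddMonoidHom (ZMod n))

/-- The growth function. -/
noncomputable def gg (m s : ℝ) : ℕ → ℝ
  | 0 => m
  | k + 1 => gg m s k + min (gg m s k) s / 96

lemma gg_pos (m s : ℝ) (hm : 0 < m) (hs : 0 < s) (k : ℕ) : 0 < gg m s k := by
  induction k with
  | zero => exact hm
  | succ k ih =>
    have : 0 < min (gg m s k) s := lt_min ih hs
    simp only [gg]; positivity

lemma gg_exp (m s : ℝ) (hm : 0 < m) (hs : 0 < s) (k : ℕ) :
    min s (m * (97 / 96) ^ k) ≤ gg m s k := by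
  induction k with
  | zero => simp [gg]
  | succ k ih =>
    simp only [gg]
    have hp := gg_pos m s hm hs k
    rcases le_total s (gg m s k) with h | h
    · rw [min_eq_right h]
      exact (min_le_left _ _).trans (by linarith)
    · rw [min_eq_left h]
      rcases le_total s (m * (97 / 96) ^ k) with h' | h'
      · rw [min_eq_left h'] at ih
        exact (min_le_left _ _).trans (by linarith)
      · rw [min_eq_right h'] at ih
        refine (min_le_right _ _).trans ?_
        rw [pow_succ]; linarith

lemma gg_lin (m s : ℝ) (hs : 0 < s) (a : ℕ) (ha : s ≤ gg m s a) (b : ℕ) :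
    s + b * s / 96 ≤ gg m s (a + b) := by
  induction b with
  | zero => simpa using ha
  | succ b ih =>
    rw [← add_assoc]
    simp only [gg]
    have : s ≤ gg m s (a + b) := le_trans (by have : 0 ≤ b * s / 96 := by positivity
                                              linarith) ih
    rw [min_eq_right this]
    push_cast
    linarith

lemma process (n : ℕ) [NeZero n] (A : ι → Finset ℕ) (h0 : ∀ i, 0 ∈ A i) (J : Finset ι)
    (m s : ℝ) (hs : 0 < s) (t : ℕ) (i₀ : ι) (hi₀ : i₀ ∈ J)
    (hmi : m ≤ #(im n (A i₀)))
    (halive : ∀ U ⊆ J, #U ≤ t + 1 → s ≤ #(im n ((J \ U).biUnion A)))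
    (hg : (n : ℝ) < gg m s t) :
    ∃ U ⊆ J, #U ≤ t + 1 ∧
      Fini (im n (Sm A U)) (AddSubgroup.closure (im n ((J \ U).biUnion A) : Set (ZMod n))) := by
  by_contra! hcon
  have key : ∀ k ≤ t, ∃ U ⊆ J, #U ≤ k + 1 ∧ gg m s k ≤ #(im n (Sm A U)) := by
    intro k
    induction k with
    | zero =>
      intro _
      refine ⟨{i₀}, by simpa using hi₀, by simp, ?_⟩
      simpa [gg, Sm] using hmi
    | succ k ih =>
      intro hk
      obtain ⟨U, hUJ, hUc, hUg⟩ := ih (by omega)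
      have hS := halive U hUJ (by omega)
      have hF := hcon U hUJ (by omega)
      have hT : (im n (Sm A U)).Nonempty := by
        refine ⟨((0 : ℕ) : ZMod n), mem_image_of_mem _ (Sm_zero A h0 U)⟩
      have hSn : (im n ((J \ U).biUnion A)).Nonempty := by
        rw [← card_pos]
        have : (0 : ℝ) < #(im n ((J \ U).biUnion A)) := lt_of_lt_of_le hs hS
        exact_mod_cast this
      rcases step _ _ hT hSn with h | ⟨x, hx, hd⟩
      · exact absurd h hF
      · unfold im at hx
        simp only [mem_image, mem_biUnion, mem_sdiff] at hx
        obtain ⟨y, ⟨i, ⟨hiJ, hiU⟩, hy⟩, rfl⟩ := hx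
        refine ⟨insert i U, insert_subset hiJ hUJ, ?_, ?_⟩
        · rw [card_insert_of_notMem hiU]; omega
        · have hsub : im n (Sm A U) ∪ (((y : ZMod n) +ᵥ im n (Sm A U)) \ im n (Sm A U)) ⊆
              im n (Sm A (insert i U)) := by
            rw [Sm_insert A hiU, im_add]
            intro w hw
            simp only [mem_union, mem_sdiff] at hw
            rcases hw with hw | ⟨hw, _⟩
            · have := add_mem_add (mem_image_of_mem (fun x : ℕ => (x : ZMod n)) (h0 i)) hw
              simpa [im] using this
            · obtain ⟨v, hv, rfl⟩ := mem_vadd_finset.mp hw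
              exact add_mem_add (mem_image_of_mem (fun x : ℕ => (x : ZMod n)) hy) hv
          have hc := card_le_card hsub
          rw [card_union_of_disjoint disjoint_sdiff] at hc
          change _ + dd _ _ ≤ _ at hc
          have hc' : (#(im n (Sm A U)) : ℝ) + dd (im n (Sm A U)) (y : ZMod n) ≤
            #(im n (Sm A (insert i U))) := by exact_mod_cast hc
          have hd' : min (#(im n (Sm A U)) : ℝ) #(im n ((J \ U).biUnion A)) ≤
            96 * dd (im n (Sm A U)) (y : ZMod n) := by exact_mod_cast hd.le
          simp only [gg]
          have h3 : min (gg m s k) s ≤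
            min (#(im n (Sm A U)) : ℝ) #(im n ((J \ U).biUnion A)) := min_le_min hUg hS
          linarith
  obtain ⟨U, _, _, hU⟩ := key t le_rfl
  have h1 : #(im n (Sm A U)) ≤ n := by
    have := card_le_univ (im n (Sm A U))
    rwa [ZMod.card] at this
  have h2 : (#(im n (Sm A U)) : ℝ) ≤ n := by exact_mod_cast h1
  linarith

lemma extend (A : ι → Finset ℕ) (h0 : ∀ i, 0 ∈ A i) (d u z α : ℕ) (X : Finset ℕ) (a : ι → ℕ)
    (β : ℕ) (hαβ : α + u ≤ β)
    (hX : ∀ x, α ≤ x → x ≤ β → x ≡ z [MOD d] → x ∈ X) (R : Finset ι)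
    (ha : ∀ i ∈ R, a i ∈ A i ∧ a i ≤ u ∧ d ∣ a i) :
    ∀ x, α ≤ x → x ≤ β + ∑ i ∈ R, a i → x ≡ z [MOD d] → x ∈ X + Sm A R := by
  induction R using Finset.induction_on with
  | empty => simpa [Sm] using hX
  | insert i R hi ih =>
    have ih' := ih (fun j hj => ha j (mem_insert_of_mem hj))
    obtain ⟨h1, h2, h3⟩ := ha i (mem_insert_self _ _)
    intro x hx hx' hxz
    rw [Finset.sum_insert hi] at hx'
    rw [Sm_insert A hi, add_left_comm]
    by_cases hc : x ≤ β + ∑ i ∈ R, a i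
    · simpa using add_mem_add (h0 i) (ih' x hx hc hxz)
    · push Not at hc
      have hax : a i ≤ x := by omega
      have : x = a i + (x - a i) := by omega
      rw [this]
      refine add_mem_add h1 (ih' _ (by omega) (by omega) ?_)
      have e : x - a i + a i ≡ x - a i [MOD d] := by
        simpa using (Nat.ModEq.refl (x - a i)).add ((Nat.modEq_zero_iff_dvd).2 h3)
      rw [Nat.sub_add_cancel hax] at e
      exact e.symm.trans hxz

/-- Either long multiples of `n` are representable, or few indices hit everything. -/
lemma pbuild (A : ι → Finset ℕ) (h0 : ∀ i, 0 ∈ A i) (I : Finset ι) (n M : ℕ) :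
    (∃ F ⊆ I, #F ≤ 2 * M ∧ ∀ j ≤ M, j * n ∈ Sm A F) ∨
    (∃ F ⊆ I, #F ≤ 2 * M ∧ ∀ i ∈ I \ F, ∀ j ∈ I \ F, i ≠ j → n ∉ A i + A j) := by
  induction M with
  | zero => left; exact ⟨∅, by simp, by simp, by simp [Sm]⟩
  | succ M ih =>
    rcases ih with ⟨F, hF, hc, hj⟩ | ⟨F, hF, hc, hj⟩
    · by_cases hex : ∃ i ∈ I \ F, ∃ j ∈ I \ F, i ≠ j ∧ n ∈ A i + A j
      · left
        obtain ⟨i, hi, j, hjj, hij, hn⟩ := hex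
        simp only [mem_sdiff] at hi hjj
        have hj2 : j ∉ F := hjj.2
        have hi2 : i ∉ insert j F := by simp [hij, hi.2]
        refine ⟨insert i (insert j F), ?_, ?_, ?_⟩
        · exact insert_subset hi.1 (insert_subset hjj.1 hF)
        · rw [card_insert_of_notMem hi2, card_insert_of_notMem hj2]; omega
        · intro k hk
          rw [Sm_insert A hi2, Sm_insert A hj2, ← add_assoc]
          rcases Nat.lt_or_ge M k with h | h
          · have : k = M + 1 := by omega
            subst this
            rw [add_mul, one_mul, add_comm (M * n) n]
            exact add_mem_add hn (hj M le_rfl)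
          · simpa using add_mem_add (add_mem_add (h0 i) (h0 j)) (hj k h)
      · right
        push Not at hex
        exact ⟨F, hF, by omega, hex⟩
    · right; exact ⟨F, hF, by omega, hj⟩

end proc

section choosen
variable {ι : Type*} [DecidableEq ι]

lemma opt1 (A : ι → Finset ℕ) (h0 : ∀ i, 0 ∈ A i) (I : Finset ι) (x M : ℕ)
    (hK : 2 * M < #(I.filter (fun i => x ∈ A i))) (hl : 2 * M + 2 ≤ #I) :
    ∃ F ⊆ I, #F ≤ 2 * M ∧ ∀ j ≤ M, j * x ∈ Sm A F := by
  rcases pbuild A h0 I x M with h | ⟨F, hF, hc, hj⟩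
  · exact h
  · exfalso
    obtain ⟨i, hi, hiF⟩ := exists_mem_notMem_of_card_lt_card (lt_of_le_of_lt hc hK)
    simp only [mem_filter] at hi
    have : #(insert i F) < #I := by
      have := card_insert_le i F
      omega
    obtain ⟨j, hj1, hj2⟩ := exists_mem_notMem_of_card_lt_card this
    simp only [mem_insert, not_or] at hj2
    refine hj i (mem_sdiff.2 ⟨hi.1, hiF⟩) j (mem_sdiff.2 ⟨hj1, hj2.2⟩) (Ne.symm hj2.1) ?_
    simpa using add_mem_add hi.2 (h0 j)

/-- Number of representations of `n` as a sum of an element of `B i` and one of `B j`. -/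
def rc (B : ι → Finset ℕ) (n : ℕ) (i j : ι) : ℕ := #((B i).filter (fun x => n - x ∈ B j))


lemma rc_comm (B : ι → Finset ℕ) (hB : ∀ i, 0 ∉ B i) (n : ℕ) (i j : ι) :
    rc B n i j = rc B n j i := by
  have key : ∀ i j, rc B n i j ≤ rc B n j i := by
    intro i j
    unfold rc
    apply card_le_card_of_injOn (fun x => n - x)
    · intro x hx
      simp only [coe_filter, Set.mem_ofPred_eq] at hx ⊢
      have : n - x ≠ 0 := fun h => hB j (h ▸ hx.2)
      have e : n - (n - x) = x := by omega
      rw [e]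
      exact ⟨hx.2, hx.1⟩
    · intro x hx y hy hxy
      simp only [coe_filter, Set.mem_ofPred_eq] at hx hy hxy
      have : n - x ≠ 0 := fun h => hB j (h ▸ hx.2)
      omega
  exact le_antisymm (key i j) (key j i)

lemma opt2 (A B : ι → Finset ℕ) (h0 : ∀ i, 0 ∈ A i) (I : Finset ι) (u m K M : ℕ)
    (hBA : ∀ i, B i ⊆ A i) (hBu : ∀ i, B i ⊆ Ioc (u / 2) u) (hBm : ∀ i ∈ I, #(B i) = m)
    (hK : ∀ x, #(I.filter (fun i => x ∈ B i)) ≤ K)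
    (hlt : 8 * u * M * (m * K) < (#I * #I - #I) * (m * m)) :
    ∃ n, u / 2 < n ∧ n ≤ 2 * u ∧ ∃ F ⊆ I, #F ≤ 2 * M ∧ ∀ j ≤ M, j * n ∈ Sm A F := by
  by_contra! hcon
  have hB0 : ∀ i, 0 ∉ B i := by
    intro i h; have := hBu i h; simp at this
  set R := Ioc (u / 2) (2 * u) with hR
  have hRc : #R ≤ 2 * u := by simp [hR]
  have hF : ∀ n ∈ R, ∃ F ⊆ I, #F ≤ 2 * M ∧ ∀ i ∈ I \ F, ∀ j ∈ I \ F, i ≠ j → n ∉ A i + A j := by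
    intro n hn
    simp only [hR, mem_Ioc] at hn
    rcases pbuild A h0 I n M with ⟨F, h1, h2, h3⟩ | h
    · obtain ⟨j, hj, hj'⟩ := hcon n hn.1 hn.2 F h1 h2
      exact absurd (h3 j hj) hj'
    · exact h
  have row : ∀ n, ∀ i ∈ I, ∑ j ∈ I, rc B n i j ≤ m * K := by
    intro n i hi
    unfold rc
    simp_rw [card_filter]
    rw [Finset.sum_comm]
    rw [← hBm i hi, ← smul_eq_mul, ← Finset.sum_const]
    refine Finset.sum_le_sum fun x _ => ?_
    rw [← card_filter]
    exact hK _
  have tot : ∀ n ∈ R, ∑ p ∈ I.offDiag, rc B n p.1 p.2 ≤ 4 * M * (m * K) := by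
    intro n hn
    obtain ⟨F, h1, h2, h3⟩ := hF n hn
    have e1 : ∑ p ∈ I.offDiag, rc B n p.1 p.2 ≤
        ∑ p ∈ I ×ˢ I, ((if p.1 ∈ F then rc B n p.1 p.2 else 0) +
          (if p.2 ∈ F then rc B n p.1 p.2 else 0)) := by
      refine le_trans (Finset.sum_le_sum (g := fun p =>
        ((if p.1 ∈ F then rc B n p.1 p.2 else 0) +
          (if p.2 ∈ F then rc B n p.1 p.2 else 0))) ?_)
        (Finset.sum_le_sum_of_subset ?_)
      · rintro ⟨i, j⟩ hp
        simp only [mem_offDiag] at hp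
        obtain ⟨hi, hj, hij⟩ := hp
        by_cases hiF : i ∈ F
        · simp [hiF]
        by_cases hjF : j ∈ F
        · simp [hjF]
        have hz : rc B n i j = 0 := by
          unfold rc
          rw [card_eq_zero, filter_eq_empty_iff]
          intro x hx hx'
          apply h3 i (mem_sdiff.2 ⟨hi, hiF⟩) j (mem_sdiff.2 ⟨hj, hjF⟩) hij
          have : n - x ≠ 0 := fun h => hB0 j (h ▸ hx')
          have e : n = x + (n - x) := by omega
          rw [e]
          exact add_mem_add (hBA i hx) (hBA j hx')
        simp [hz]
      · intro p hp
        simp only [mem_offDiag] at hp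
        exact mem_product.2 ⟨hp.1, hp.2.1⟩
    refine e1.trans ?_
    have hFs : ∀ (f : ι → ℕ), (∀ i ∈ I, f i ≤ m * K) →
        ∑ i ∈ I, (if i ∈ F then f i else 0) ≤ 2 * M * (m * K) := by
      intro f hf
      rw [← Finset.sum_filter]
      calc _ ≤ ∑ i ∈ I.filter (· ∈ F), m * K :=
            Finset.sum_le_sum fun i hi => hf i (mem_filter.1 hi).1
        _ = #(I.filter (· ∈ F)) * (m * K) := by simp
        _ ≤ _ := by
          apply Nat.mul_le_mul_right
          refine (card_le_card ?_).trans h2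
          intro i hi; exact (mem_filter.1 hi).2
    rw [Finset.sum_add_distrib]
    have f1 : ∑ p ∈ I ×ˢ I, (if p.1 ∈ F then rc B n p.1 p.2 else 0) ≤ 2 * M * (m * K) := by
      rw [Finset.sum_product]
      refine le_trans (le_of_eq ?_) (hFs (fun i => ∑ j ∈ I, rc B n i j) (row n))
      refine Finset.sum_congr rfl fun i _ => ?_
      by_cases h : i ∈ F <;> simp [h]
    have f2 : ∑ p ∈ I ×ˢ I, (if p.2 ∈ F then rc B n p.1 p.2 else 0) ≤ 2 * M * (m * K) := by
      rw [Finset.sum_product_right]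
      refine le_trans (le_of_eq ?_) (hFs (fun i => ∑ j ∈ I, rc B n i j) (row n))
      refine Finset.sum_congr rfl fun i _ => ?_
      by_cases h : i ∈ F
      · simp only [h, if_true]
        exact Finset.sum_congr rfl fun j _ => rc_comm B hB0 n j i
      · simp [h]
    linarith
  have low : (#I * #I - #I) * (m * m) ≤ ∑ p ∈ I.offDiag, ∑ n ∈ R, rc B n p.1 p.2 := by
    rw [← offDiag_card, ← smul_eq_mul, ← Finset.sum_const]
    refine Finset.sum_le_sum ?_
    rintro ⟨i, j⟩ hp
    simp only [mem_offDiag] at hp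
    unfold rc
    simp_rw [card_filter]
    rw [Finset.sum_comm]
    simp_rw [← card_filter]
    calc m * m = ∑ x ∈ B i, m := by simp [hBm i hp.1]
      _ ≤ _ := by
        refine Finset.sum_le_sum fun x hx => ?_
        rw [← hBm j hp.2.1]
        apply card_le_card_of_injOn (fun y => x + y)
        · intro y hy
          have a1 := hBu i hx
          have a2 := hBu j hy
          simp only [mem_Ioc] at a1 a2
          simp only [hR, coe_filter, Set.mem_ofPred_eq, mem_Ioc, Nat.add_sub_cancel_left]
          exact ⟨by omega, hy⟩
        · intro y _ y' _ h; simpa using h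
  rw [Finset.sum_comm] at low
  have up : ∑ n ∈ R, ∑ p ∈ I.offDiag, rc B n p.1 p.2 ≤ #R * (4 * M * (m * K)) := by
    rw [← smul_eq_mul, ← Finset.sum_const]
    exact Finset.sum_le_sum tot
  have up2 : #R * (4 * M * (m * K)) ≤ 2 * u * (4 * M * (m * K)) := Nat.mul_le_mul_right _ hRc
  have : 2 * u * (4 * M * (m * K)) = 8 * u * M * (m * K) := by ring
  omega

end choosen

section final
variable {ι : Type*} [DecidableEq ι]

lemma exists_gen (n : ℕ) [NeZero n] (H : AddSubgroup (ZMod n)) :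
    ∃ d : ℕ, 0 < d ∧ ∀ x : ℤ, ((x : ZMod n) ∈ H ↔ (d : ℤ) ∣ x) := by
  obtain ⟨a, ha⟩ := Int.subgroup_cyclic (H.comap (Int.castAddHom (ZMod n)))
  have key : ∀ x : ℤ, ((x : ZMod n) ∈ H ↔ a ∣ x) := by
    intro x
    have h1 : (x : ZMod n) ∈ H ↔ x ∈ H.comap (Int.castAddHom (ZMod n)) := by simp
    rw [h1, ha, AddSubgroup.mem_closure_singleton]
    constructor
    · rintro ⟨k, rfl⟩; simp
    · rintro ⟨k, rfl⟩; exact ⟨k, by simp [mul_comm]⟩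
  refine ⟨a.natAbs, ?_, fun x => by rw [key, Int.natAbs_dvd]⟩
  rw [Int.natAbs_pos]
  rintro rfl
  have := (key n).1 (by simp [H.zero_mem])
  simp [NeZero.ne n] at this

lemma exists_base (d α z : ℕ) (hd : 0 < d) : ∃ a, α ≤ a ∧ a < α + d ∧ a ≡ z [MOD d] := by
  obtain ⟨e, rfl⟩ : ∃ e, d = e + 1 := ⟨d - 1, by omega⟩
  refine ⟨α + (z + α * e) % (e + 1), by omega, ?_, ?_⟩
  · have := Nat.mod_lt (z + α * e) hd
    omega
  · have h1 : α + (z + α * e) % (e + 1) ≡ α + (z + α * e) [MOD (e + 1)] :=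
      (Nat.ModEq.refl α).add (Nat.mod_modEq _ _)
    have h2 : α + (z + α * e) = z + (e + 1) * α := by ring
    rw [h2] at h1
    refine h1.trans ?_
    simp [Nat.ModEq]

lemma finish (n : ℕ) [NeZero n] (A : ι → Finset ℕ) (h0 : ∀ i, 0 ∈ A i) (u t M m : ℕ)
    (hu : ∀ i, ∀ x ∈ A i, x ≤ u) (hn : u / 2 < n) (hM : 4 * t + 6 ≤ M)
    (F U₁ U₂ R : Finset ι) (hFU₁ : Disjoint F U₁) (hFU₂ : Disjoint F U₂)
    (hUU : Disjoint U₁ U₂) (hRF : Disjoint R F) (hR₁ : Disjoint R U₁) (hR₂ : Disjoint R U₂)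
    (hP : ∀ j ≤ M, j * n ∈ Sm A F) (hc₁ : #U₁ ≤ t + 1) (hc₂ : #U₂ ≤ t + 1)
    (hf₁ : Fini (im n (Sm A U₁)) (AddSubgroup.closure (im n (R.biUnion A) : Set (ZMod n))))
    (hf₂ : Fini (im n (Sm A U₂)) (AddSubgroup.closure (im n (R.biUnion A) : Set (ZMod n))))
    (hm : ∀ i ∈ R, m + 1 ≤ #(A i)) :
    ∃ k a Δ : ℕ, 0 < Δ ∧ #R * m ≤ k ∧ ∀ j < k, a + j * Δ ∈ Sm A (F ∪ U₁ ∪ U₂ ∪ R) := by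
  obtain ⟨z, hz⟩ := hf₁.add hf₂
  rw [← im_add, ← Sm_union A hUU] at hz
  set H := AddSubgroup.closure (im n (R.biUnion A) : Set (ZMod n)) with hH
  obtain ⟨d, hd, hdH⟩ := exists_gen n H
  have hdvd : ∀ i ∈ R, ∀ x ∈ A i, d ∣ x := by
    intro i hi x hx
    have : ((x : ℤ) : ZMod n) ∈ H := by
      apply AddSubgroup.subset_closure
      simp only [im, coe_image, Set.mem_image, Int.cast_natCast]
      exact ⟨x, by simpa using ⟨i, hi, hx⟩, rfl⟩
    rw [hdH] at this
    exact_mod_cast this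
  set z₀ := z.val with hz₀
  set W := 2 * (t + 1) * u with hW
  have hWle : ∀ x ∈ Sm A (U₁ ∪ U₂), x ≤ W := by
    intro x hx
    have h1 := Sm_le A u (U₁ ∪ U₂) (fun i _ => hu i) x hx
    have h2 : #(U₁ ∪ U₂) ≤ 2 * (t + 1) := (card_union_le _ _).trans (by omega)
    exact h1.trans (Nat.mul_le_mul_right _ h2)
  have hbase : ∀ x, W ≤ x → x ≤ M * n → x ≡ z₀ [MOD d] → x ∈ Sm A F + Sm A (U₁ ∪ U₂) := by
    intro x hx1 hx2 hxz
    have h1 : (((x : ℤ) - (z₀ : ℤ) : ℤ) : ZMod n) ∈ H := by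
      rw [hdH]
      exact (Nat.modEq_iff_dvd.1 hxz.symm)
    have h2 := hz _ h1
    have h3 : z + (((x : ℤ) - (z₀ : ℤ) : ℤ) : ZMod n) = (x : ZMod n) := by
      push_cast
      rw [hz₀, ZMod.natCast_zmod_val]; ring
    rw [h3] at h2
    simp only [im, mem_image] at h2
    obtain ⟨y, hy, hyx⟩ := h2
    have hyW := hWle y hy
    rw [ZMod.natCast_eq_natCast_iff] at hyx
    obtain ⟨j, hj⟩ := (Nat.modEq_iff_dvd' (hyW.trans hx1)).1 hyx
    have hxe : x = j * n + y := by
      have : x - y + y = x := Nat.sub_add_cancel (hyW.trans hx1)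
      rw [← this, hj]; ring
    rw [hxe]
    refine add_mem_add (hP j ?_) hy
    by_contra! hjM
    have : (M + 1) * n ≤ j * n := Nat.mul_le_mul_right _ hjM
    have : 0 < n := Nat.pos_of_ne_zero (NeZero.ne n)
    nlinarith
  have hWM : W + u ≤ M * n := by
    have h1 : (4 * t + 6) * n ≤ M * n := Nat.mul_le_mul_right _ hM
    have h2 : u ≤ 2 * n := by omega
    have h3 : (2 * t + 3) * u ≤ (2 * t + 3) * (2 * n) := Nat.mul_le_mul_left _ h2
    rw [hW]
    nlinarith
  set a : ι → ℕ := fun i => (A i).max' ⟨0, h0 i⟩ with ha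
  have haA : ∀ i, a i ∈ A i := fun i => max'_mem _ _
  have hext := extend A h0 d u z₀ W (Sm A F + Sm A (U₁ ∪ U₂)) a (M * n) hWM hbase R
    (fun i hi => ⟨haA i, hu i _ (haA i), hdvd i hi _ (haA i)⟩)
  have hSm : Sm A F + Sm A (U₁ ∪ U₂) + Sm A R = Sm A (F ∪ U₁ ∪ U₂ ∪ R) := by
    rw [← Sm_union A, ← Sm_union A, ← union_assoc]
    · rw [disjoint_union_left, disjoint_union_left]
      exact ⟨hRF.symm, hR₁.symm, hR₂.symm⟩
    · rw [disjoint_union_right]; exact ⟨hFU₁, hFU₂⟩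
  rw [hSm] at hext
  obtain ⟨b, hb1, hb2, hb3⟩ := exists_base d W z₀ hd
  refine ⟨∑ i ∈ R, a i / d, b, d, hd, ?_, ?_⟩
  · rw [← smul_eq_mul, ← Finset.sum_const]
    refine Finset.sum_le_sum fun i hi => ?_
    have hsub : A i ⊆ (range (a i / d + 1)).image (fun j => d * j) := by
      intro x hx
      obtain ⟨j, rfl⟩ := hdvd i hi x hx
      refine mem_image_of_mem _ (mem_range.2 ?_)
      have : d * j ≤ a i := le_max' _ _ hx
      have := (Nat.le_div_iff_mul_le hd).2 (show j * d ≤ a i by rwa [mul_comm])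
      omega
    have h1 := card_le_card hsub
    have h2 := card_image_le (s := range (a i / d + 1)) (f := fun j => d * j)
    rw [card_range] at h2
    have := hm i hi
    omega
  · intro j hj
    apply hext
    · exact hb1.trans (Nat.le_add_right _ _)
    · have h1 : (∑ i ∈ R, a i / d) * d = ∑ i ∈ R, a i := by
        rw [Finset.sum_mul]
        exact Finset.sum_congr rfl fun i hi => Nat.div_mul_cancel (hdvd i hi _ (haA i))
      have h2 : (j + 1) * d ≤ (∑ i ∈ R, a i / d) * d := Nat.mul_le_mul_right _ hj
      nlinarith
    · have : b + j * d ≡ b [MOD d] := by simp [Nat.ModEq]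
      exact this.trans hb3

end final

lemma pow_big (a : ℕ) (ha : 2000 ≤ a) : ((a : ℝ) + 1) ^ 2 ≤ (97 / 96 : ℝ) ^ a := by
  induction a, ha using Nat.le_induction with
  | base =>
    have h1 : (8 : ℝ) ≤ (97 / 96 : ℝ) ^ 225 := by norm_num
    have h2 : (8 : ℝ) ^ 8 ≤ ((97 / 96 : ℝ) ^ 225) ^ 8 := pow_le_pow_left₀ (by norm_num) h1 8
    rw [← pow_mul] at h2
    have h3 : (97 / 96 : ℝ) ^ (225 * 8) ≤ (97 / 96 : ℝ) ^ 2000 :=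
      pow_le_pow_right₀ (by norm_num) (by norm_num)
    refine le_trans ?_ (h2.trans h3)
    norm_num
  | succ a ha ih =>
    rw [pow_succ (97 / 96 : ℝ) a]
    have : (2000 : ℝ) ≤ a := by exact_mod_cast ha
    push_cast
    nlinarith

lemma im_inj (n u : ℕ) (hn : u / 2 < n) (X : Finset ℕ) (hX : X ⊆ Ioc (u / 2) u) :
    #(im n X) = #X := by
  unfold im
  apply card_image_of_injOn
  have key : ∀ x ∈ X, ∀ y ∈ X, x ≤ y → (x : ZMod n) = (y : ZMod n) → x = y := by
    intro x hx y hy hxy h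
    have h1 := hX hx
    have h2 := hX hy
    simp only [mem_Ioc] at h1 h2
    rw [ZMod.natCast_eq_natCast_iff, Nat.modEq_iff_dvd' hxy] at h
    have := Nat.eq_zero_of_dvd_of_lt h (by omega)
    omega
  intro x hx y hy h
  rcases le_total x y with hxy | hxy
  · exact key x hx y hy hxy h
  · exact (key y hy x hx hxy h.symm).symm

section mainprop
variable {ι : Type*} [DecidableEq ι]

lemma count_le (B : ι → Finset ℕ) (I V : Finset ι) (hV : V ⊆ I) (m K : ℕ)
    (hB : ∀ i ∈ I, #(B i) = m) (hK : ∀ x, #(I.filter (fun i => x ∈ B i)) ≤ K) :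
    #V * m ≤ #(V.biUnion B) * K := by
  calc #V * m = ∑ i ∈ V, #(B i) := by
        rw [Finset.sum_congr rfl (fun i hi => hB i (hV hi))]; simp
    _ = ∑ i ∈ V, ∑ x ∈ V.biUnion B, if x ∈ B i then 1 else 0 := by
        refine Finset.sum_congr rfl fun i hi => ?_
        rw [← card_filter]
        congr 1
        ext x
        simp only [mem_filter, mem_biUnion]
        exact ⟨fun h => ⟨⟨i, hi, h⟩, h⟩, fun h => h.2⟩
    _ = ∑ x ∈ V.biUnion B, ∑ i ∈ V, if x ∈ B i then 1 else 0 := Finset.sum_comm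
    _ ≤ ∑ x ∈ V.biUnion B, K := by
        refine Finset.sum_le_sum fun x _ => ?_
        rw [← card_filter]
        exact (card_le_card (filter_subset_filter _ hV)).trans (hK x)
    _ = _ := by simp

lemma main_prop (A : ι → Finset ℕ) (h0 : ∀ i, 0 ∈ A i) (I' I : Finset ι) (hII : I ⊆ I')
    (u m₁ m₂ : ℕ) (hu0 : 0 < u) (hm₂ : 0 < m₂) (hA : ∀ i, ∀ x ∈ A i, x ≤ u)
    (hm₁ : ∀ i ∈ I', m₁ + 1 ≤ #(A i))
    (hAB : ∀ i ∈ I, m₂ ≤ #((A i).filter (fun x => u / 2 < x)))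
    (hc : 4000000 * u ≤ #I * m₂) :
    ∃ k a Δ : ℕ, 0 < Δ ∧ #I' * m₁ ≤ 2 * k ∧ ∀ j < k, a + j * Δ ∈ Sm A I' := by
  have hex : ∀ i, ∃ B ⊆ (A i).filter (fun x => u / 2 < x), i ∈ I → #B = m₂ := by
    intro i
    by_cases hi : i ∈ I
    · obtain ⟨B, h1, h2⟩ := exists_subset_card_eq (hAB i hi)
      exact ⟨B, h1, fun _ => h2⟩
    · exact ⟨∅, by simp, fun h => absurd h hi⟩
  choose B hBsub hBm using hex
  have hBA : ∀ i, B i ⊆ A i := fun i => (hBsub i).trans (filter_subset _ _)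
  have hBu : ∀ i, B i ⊆ Ioc (u / 2) u := by
    intro i x hx
    have := mem_filter.1 (hBsub i hx)
    exact mem_Ioc.2 ⟨this.2, hA i x this.1⟩
  obtain ⟨x₀, hx₀, hmax⟩ := exists_max_image (Ioc (u / 2) u)
    (fun x => #(I.filter (fun i => x ∈ B i))) ⟨u, by simp; omega⟩
  set K := #(I.filter (fun i => x₀ ∈ B i)) with hKdef
  have hK : ∀ x, #(I.filter (fun i => x ∈ B i)) ≤ K := by
    intro x
    by_cases hx : x ∈ Ioc (u / 2) u
    · exact hmax x hx
    · rw [filter_eq_empty_iff.2]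
      · simp
      · intro i _ h; exact hx (hBu i h)
  set l := #I with hl
  have hKl : K ≤ l := card_filter_le _ _
  have hcount := fun V hV => count_le B I V hV m₂ K hBm hK
  have hbi : ∀ V : Finset ι, V.biUnion B ⊆ Ioc (u / 2) u :=
    fun V => biUnion_subset.2 fun i _ => hBu i
  have hKc : 4000000 ≤ K := by
    have h1 := hcount I (Subset.refl _)
    have h2 : #(I.biUnion B) ≤ u := (card_le_card (hbi I)).trans (by simp)
    have h3 : 4000000 * u ≤ K * u := by
      calc _ ≤ l * m₂ := hc
        _ ≤ _ := h1
        _ ≤ u * K := Nat.mul_le_mul_right _ h2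
        _ = _ := mul_comm _ _
    exact Nat.le_of_mul_le_mul_right h3 hu0
  set a := Nat.sqrt l with ha
  have ha1 : a * a ≤ l := Nat.sqrt_le l
  have ha2 : l < (a + 1) * (a + 1) := Nat.lt_succ_sqrt l
  have ha3 : 2000 ≤ a := Nat.le_sqrt.2 (by omega)
  have ha4 : 2000 * a ≤ l := (Nat.mul_le_mul_right a ha3).trans ha1
  have hq : (l : ℝ) ≤ (97 / 96 : ℝ) ^ a := by
    refine le_trans ?_ (pow_big a ha3)
    have : (l : ℝ) ≤ ((a : ℝ) + 1) * (a + 1) := by exact_mod_cast ha2.le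
    nlinarith
  obtain ⟨b, hb⟩ : ∃ b, b = K / 10000 + 1 := ⟨_, rfl⟩
  obtain ⟨t, ht⟩ : ∃ t, t = a + b := ⟨_, rfl⟩
  obtain ⟨M, hM⟩ : ∃ M, M = 4 * t + 6 := ⟨_, rfl⟩
  have hbK : 400 * K ≤ 4000000 * b := by omega
  obtain ⟨n, hn1, hn2, F, hFI, hFc, hP⟩ : ∃ n, u / 2 < n ∧ n ≤ 2 * u ∧
      ∃ F ⊆ I, #F ≤ 2 * M ∧ ∀ j ≤ M, j * n ∈ Sm A F := by
    by_cases hcase : 10 * a + 30 ≤ K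
    · have hx₀' := mem_Ioc.1 hx₀
      refine ⟨x₀, hx₀'.1, by omega, opt1 A h0 I x₀ M ?_ (by omega)⟩
      have : K ≤ #(I.filter (fun i => x₀ ∈ A i)) := by
        apply card_le_card
        intro i hi
        rw [mem_filter] at hi ⊢
        exact ⟨hi.1, hBA i hi.2⟩
      omega
    · apply opt2 A B h0 I u m₂ K M hBA hBu hBm hK
      have e1 : M ≤ 9 * a := by omega
      have e2 : K ≤ 11 * a := by omega
      have e3 : M * K ≤ 99 * l := by
        calc M * K ≤ (9 * a) * (11 * a) := Nat.mul_le_mul e1 e2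
          _ = 99 * (a * a) := by ring
          _ ≤ _ := Nat.mul_le_mul_left _ ha1
      rw [← hl]
      have e4 : l * l - l = (l - 1) * l := by rw [Nat.sub_mul, one_mul]
      rw [e4]
      have e5 : 4000 * l < 4000000 * (l - 1) := by omega
      calc 8 * u * M * (m₂ * K) = (8 * (M * K)) * (u * m₂) := by ring
        _ ≤ (4000 * l) * (u * m₂) := Nat.mul_le_mul_right _ (by omega)
        _ < (4000000 * (l - 1)) * (u * m₂) :=
            Nat.mul_lt_mul_of_pos_right e5 (Nat.mul_pos hu0 hm₂)
        _ = (l - 1) * m₂ * (4000000 * u) := by ring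
        _ ≤ (l - 1) * m₂ * (l * m₂) := Nat.mul_le_mul_left _ hc
        _ = _ := by ring
  haveI : NeZero n := ⟨by omega⟩
  have hu0' : (0 : ℝ) < u := by exact_mod_cast hu0
  have hm0' : (0 : ℝ) < m₂ := by exact_mod_cast hm₂
  have hl0' : (0 : ℝ) < l := by
    have : 0 < l := by omega
    exact_mod_cast this
  have hK0' : (1 : ℝ) ≤ K := by
    have : 1 ≤ K := by omega
    exact_mod_cast this
  have hc' : 4000000 * (u : ℝ) ≤ l * m₂ := by exact_mod_cast hc
  have hbK' : 400 * (K : ℝ) ≤ 4000000 * b := by exact_mod_cast hbK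
  set s : ℝ := l * m₂ / (2 * K) with hs
  have hs0 : 0 < s := by positivity
  have hused : 2 * (10 * t + 14) ≤ l := by omega
  have alive : ∀ E : Finset ι, #E ≤ 10 * t + 14 → s ≤ #(im n ((I' \ E).biUnion A)) := by
    intro E hE
    have h1 : (I \ E).biUnion B ⊆ (I' \ E).biUnion A := by
      intro x hx
      simp only [mem_biUnion, mem_sdiff] at hx ⊢
      obtain ⟨i, ⟨hi, hiE⟩, hx⟩ := hx
      exact ⟨i, ⟨hII hi, hiE⟩, hBA i hx⟩
    have h2 : #((I \ E).biUnion B) ≤ #(im n ((I' \ E).biUnion A)) := by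
      rw [← im_inj n u hn1 _ (hbi (I \ E))]
      exact card_le_card (image_subset_image h1)
    have h3 := hcount (I \ E) sdiff_subset
    have h4 : l ≤ 2 * #(I \ E) := by
      have := le_card_sdiff E I
      omega
    have h5 : l * m₂ ≤ #(im n ((I' \ E).biUnion A)) * (2 * K) := by
      calc l * m₂ ≤ 2 * #(I \ E) * m₂ := Nat.mul_le_mul_right _ h4
        _ = 2 * (#(I \ E) * m₂) := by ring
        _ ≤ 2 * (#((I \ E).biUnion B) * K) := Nat.mul_le_mul_left _ h3
        _ ≤ 2 * (#(im n ((I' \ E).biUnion A)) * K) :=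
            Nat.mul_le_mul_left _ (Nat.mul_le_mul_right _ h2)
        _ = _ := by ring
    rw [hs, div_le_iff₀ (by positivity)]
    exact_mod_cast h5
  have hg : (n : ℝ) < gg m₂ s t := by
    have hsl : s ≤ l * m₂ := by
      rw [hs, div_le_iff₀ (by positivity)]
      nlinarith [mul_pos hl0' hm0']
    have h1 : s ≤ gg m₂ s a := by
      refine le_trans ?_ (gg_exp m₂ s hm0' hs0 a)
      refine le_min le_rfl (hsl.trans ?_)
      rw [mul_comm]
      exact mul_le_mul_of_nonneg_left hq hm0'.le
    have h2 := gg_lin m₂ s hs0 a h1 b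
    rw [← ht] at h2
    have h3 : 192 * (u : ℝ) ≤ b * s := by
      rw [hs, ← mul_div_assoc, le_div_iff₀ (by positivity)]
      have hb0 : (0 : ℝ) ≤ b := Nat.cast_nonneg b
      have e1 : b * (4000000 * (u : ℝ)) ≤ b * (l * m₂) := mul_le_mul_of_nonneg_left hc' hb0
      have e2 : 400 * (K : ℝ) * u ≤ 4000000 * b * u := mul_le_mul_of_nonneg_right hbK' hu0'.le
      nlinarith [mul_pos (lt_of_lt_of_le one_pos hK0') hu0']
    have h4 : (n : ℝ) ≤ 2 * u := by exact_mod_cast hn2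
    linarith
  have start : ∀ E : Finset ι, #E ≤ 10 * t + 14 → ∃ i ∈ I' \ E, (m₂ : ℝ) ≤ #(im n (A i)) := by
    intro E hE
    obtain ⟨i, hi, hiE⟩ := exists_mem_notMem_of_card_lt_card (show #E < #I by omega)
    refine ⟨i, mem_sdiff.2 ⟨hII hi, hiE⟩, ?_⟩
    have : m₂ ≤ #(im n (A i)) := by
      rw [← hBm i hi, ← im_inj n u hn1 _ (hBu i)]
      exact card_le_card (image_subset_image (hBA i))
    exact_mod_cast this
  obtain ⟨i₁, hi₁, him₁⟩ := start F (by omega)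
  obtain ⟨U₁, hU₁, hU₁c, hf₁⟩ := process n A h0 (I' \ F) m₂ s hs0 t i₁ hi₁ him₁
    (by
      intro U _ hUc
      rw [sdiff_sdiff_left]
      apply alive
      have := card_union_le F U
      simp only [sup_eq_union]
      omega) hg
  have hFU₁c : #(F ∪ U₁) ≤ 2 * M + (t + 1) := (card_union_le F U₁).trans (by omega)
  obtain ⟨i₂, hi₂, him₂⟩ := start (F ∪ U₁) (by omega)
  obtain ⟨U₂, hU₂, hU₂c, hf₂⟩ := process n A h0 (I' \ (F ∪ U₁)) m₂ s hs0 t i₂ hi₂ him₂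
    (by
      intro U _ hUc
      rw [sdiff_sdiff_left]
      apply alive
      have := card_union_le (F ∪ U₁) U
      simp only [sup_eq_union]
      omega) hg
  rw [sdiff_sdiff_left, sup_eq_union] at hf₁ hf₂
  have hUc : #(F ∪ U₁ ∪ U₂) ≤ 10 * t + 14 := (card_union_le _ _).trans (by omega)
  have hf₁' := hf₁.mono (H' := AddSubgroup.closure
    (im n ((I' \ (F ∪ U₁ ∪ U₂)).biUnion A) : Set (ZMod n))) (by
      apply AddSubgroup.closure_mono
      rw [coe_subset]
      apply image_subset_image
      apply biUnion_subset_biUnion_of_subset_left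
      exact sdiff_subset_sdiff (Subset.refl _) subset_union_left)
  have hdR : Disjoint (I' \ (F ∪ U₁ ∪ U₂)) (F ∪ U₁ ∪ U₂) := sdiff_disjoint
  have hd1 : Disjoint F U₁ := (disjoint_of_subset_left hU₁ sdiff_disjoint).symm
  have hd2 : Disjoint (F ∪ U₁) U₂ := (disjoint_of_subset_left hU₂ sdiff_disjoint).symm
  rw [disjoint_union_right, disjoint_union_right] at hdR
  rw [disjoint_union_left] at hd2
  obtain ⟨k, c, Δ, hΔ, hk, hAP⟩ := finish n A h0 u t M m₁ hA hn1 (by omega) F U₁ U₂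
    (I' \ (F ∪ U₁ ∪ U₂)) hd1 hd2.1 hd2.2 hdR.1.1 hdR.1.2 hdR.2 hP hU₁c hU₂c hf₁' hf₂
    (fun i hi => hm₁ i (mem_sdiff.1 hi).1)
  refine ⟨k, c, Δ, hΔ, ?_, fun j hj => Sm_mono A h0 ?_ (hAP j hj)⟩
  · have h1 := le_card_sdiff (F ∪ U₁ ∪ U₂) I'
    have h2 := card_le_card hII
    have h3 : #I' ≤ 2 * #(I' \ (F ∪ U₁ ∪ U₂)) := by omega
    calc #I' * m₁ ≤ 2 * #(I' \ (F ∪ U₁ ∪ U₂)) * m₁ := Nat.mul_le_mul_right _ h3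
      _ = 2 * (#(I' \ (F ∪ U₁ ∪ U₂)) * m₁) := by ring
      _ ≤ _ := Nat.mul_le_mul_left _ hk
  · refine union_subset (union_subset (union_subset (hFI.trans hII) ?_) ?_) sdiff_subset
    · exact hU₁.trans sdiff_subset
    · exact hU₂.trans sdiff_subset

end mainprop

/-- Number of positive elements of `X` that are at most `w`. -/
def cnt (X : Finset ℕ) (w : ℕ) : ℕ := #(X.filter (fun x => 0 < x ∧ x ≤ w))

/-- The densities used in the choice of the scale. -/
noncomputable def al (k : ℕ) : ℝ := (1 + (9 / 10 : ℝ) ^ k) / 2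

lemma cnt_filter (X : Finset ℕ) (h0 : 0 ∈ X) (w : ℕ) :
    #(X.filter (fun x => x ≤ w)) = cnt X w + 1 := by
  have : X.filter (fun x => x ≤ w) = insert 0 (X.filter (fun x => 0 < x ∧ x ≤ w)) := by
    ext x
    simp only [mem_filter, mem_insert]
    constructor
    · rintro ⟨h1, h2⟩
      rcases Nat.eq_zero_or_pos x with h | h
      · exact Or.inl h
      · exact Or.inr ⟨h1, h, h2⟩
    · rintro (rfl | h)
      · exact ⟨h0, Nat.zero_le _⟩
      · exact ⟨h.1, h.2.2⟩
  rw [this, card_insert_of_notMem (by simp)]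
  rfl

lemma cnt_split (X : Finset ℕ) (w w' : ℕ) :
    cnt X w ≤ cnt X w' + #(X.filter (fun x => w' < x ∧ x ≤ w)) := by
  unfold cnt
  refine le_trans (card_le_card ?_) (card_union_le _ _)
  intro x hx
  simp only [mem_filter, mem_union] at hx ⊢
  rcases le_or_gt x w' with h | h
  · exact Or.inl ⟨hx.1, hx.2.1, h⟩
  · exact Or.inr ⟨hx.1, h, hx.2.2⟩

lemma Sm_subset {ι : Type*} (A B : ι → Finset ℕ) (h : ∀ i, A i ⊆ B i) (J : Finset ι) :
    Sm A J ⊆ Sm B J := by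
  classical
  unfold Sm
  induction J using Finset.induction_on with
  | empty => simp
  | insert i J hi ih =>
    rw [sum_insert hi, sum_insert hi]
    exact add_subset_add (h i) ih

lemma reduce (u l n : ℕ) (hu : 0 < u) (A : Fin l → Finset ℕ) (h0 : ∀ i, 0 ∈ A i)
    (hA : ∀ i, ∀ x ∈ A i, x ≤ u) (hn : ∀ i, n + 1 ≤ #(A i))
    (hc : 1600000000 * u ≤ l * n) :
    ∃ k a Δ : ℕ, 0 < Δ ∧ u ≤ k ∧ ∀ j < k, a + j * Δ ∈ Sm A univ := by
  classical
  have hln : 0 < l * n := by omega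
  have hl : 0 < l := Nat.pos_of_mul_pos_right hln
  have hn0 : 0 < n := Nat.pos_of_mul_pos_left hln
  have hlR : (0 : ℝ) < l := by exact_mod_cast hl
  have hnR : (0 : ℝ) < n := by exact_mod_cast hn0
  have hal : ∀ k, (1 / 2 : ℝ) ≤ al k := by
    intro k
    have : (0 : ℝ) ≤ (9 / 10 : ℝ) ^ k := by positivity
    unfold al
    linarith
  let Ik : ℕ → Finset (Fin l) := fun k =>
    univ.filter (fun i => (n : ℝ) * al k ≤ cnt (A i) (u / 2 ^ k))
  let C : ℕ → Prop := fun k => (l : ℝ) * al k ≤ #(Ik k)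
  have hC0 : C 0 := by
    have : Ik 0 = univ := by
      apply filter_true_of_mem
      intro i _
      have h1 : (A i).filter (fun x => x ≤ u / 2 ^ 0) = A i := by
        apply filter_true_of_mem
        intro x hx
        simpa using hA i x hx
      have h2 := cnt_filter (A i) (h0 i) (u / 2 ^ 0)
      rw [h1] at h2
      have h3 : n ≤ cnt (A i) (u / 2 ^ 0) := by
        have := hn i
        omega
      have h4 : al 0 = 1 := by norm_num [al]
      rw [h4, mul_one]
      exact_mod_cast h3
    change (l : ℝ) * al 0 ≤ #(Ik 0)
    rw [this]
    simp [al]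
  have hpos : ∀ k, C k → 0 < u / 2 ^ k := by
    intro k hk
    by_contra hz
    have hz : u / 2 ^ k = 0 := Nat.eq_zero_of_not_pos hz
    have : Ik k = ∅ := by
      apply filter_false_of_mem
      intro i _
      rw [hz]
      have : cnt (A i) 0 = 0 := by
        unfold cnt
        rw [card_eq_zero]
        apply filter_false_of_mem
        intro x _
        omega
      rw [this]
      push_cast
      have := hal k
      nlinarith
    change (l : ℝ) * al k ≤ #(Ik k) at hk
    rw [this] at hk
    have := hal k
    simp at hk
    nlinarith
  have hex : ∃ k, ¬ C k := by
    refine ⟨u, fun h => ?_⟩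
    have h1 := hpos u h
    rw [Nat.div_eq_of_lt Nat.lt_two_pow_self] at h1
    omega
  obtain ⟨k, hk, hk1⟩ : ∃ k, C k ∧ ¬ C (k + 1) := by
    by_contra hno
    push Not at hno
    obtain ⟨k, hk⟩ := hex
    apply hk
    clear hk
    induction k with
    | zero => exact hC0
    | succ k ih => exact hno k ih
  have hv := hpos k hk
  obtain ⟨v, hvd⟩ : ∃ v, v = u / 2 ^ k := ⟨_, rfl⟩
  have hv2 : u / 2 ^ (k + 1) = v / 2 := by
    rw [hvd, pow_succ, Nat.div_div_eq_div_mul]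
  rw [← hvd] at hv
  have hvu : 2 ^ k * v ≤ u := by rw [hvd]; exact Nat.mul_div_le _ _
  obtain ⟨q, hq⟩ : ∃ q : ℝ, q = (9 / 10 : ℝ) ^ k := ⟨_, rfl⟩
  have hq0 : 0 < q := by rw [hq]; positivity
  have hdiff : al k - al (k + 1) = q / 20 := by
    unfold al
    rw [hq, pow_succ]
    ring
  change (l : ℝ) * al k ≤ #(Ik k) at hk
  change ¬ ((l : ℝ) * al (k + 1) ≤ #(Ik (k + 1))) at hk1
  push Not at hk1
  obtain ⟨I', hI'⟩ : ∃ I', I' = Ik k := ⟨_, rfl⟩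
  obtain ⟨I, hI⟩ : ∃ I, I = Ik k \ Ik (k + 1) := ⟨_, rfl⟩
  have hIc : (l : ℝ) * (q / 20) ≤ #I := by
    have h1 : #(Ik k) ≤ #I + #(Ik (k + 1)) := by
      rw [hI]
      have := le_card_sdiff (Ik (k + 1)) (Ik k)
      omega
    have h2 : (#(Ik k) : ℝ) ≤ #I + #(Ik (k + 1)) := by exact_mod_cast h1
    rw [← hdiff]
    linarith
  obtain ⟨m₁, hm₁⟩ : ∃ m₁, m₁ = (n + 1) / 2 := ⟨_, rfl⟩
  obtain ⟨m₂, hm₂⟩ : ∃ m₂, m₂ = ⌈(n : ℝ) * (q / 20)⌉₊ := ⟨_, rfl⟩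
  have hm₂0 : 0 < m₂ := by
    rw [hm₂]
    apply Nat.ceil_pos.2
    positivity
  have hm₂R : (n : ℝ) * (q / 20) ≤ m₂ := by
    rw [hm₂]
    exact Nat.le_ceil _
  obtain ⟨A', hA'⟩ : ∃ A' : Fin l → Finset ℕ, A' = fun i => (A i).filter (fun x => x ≤ v) :=
    ⟨_, rfl⟩
  have h0' : ∀ i, 0 ∈ A' i := by
    intro i
    rw [hA']
    exact mem_filter.2 ⟨h0 i, Nat.zero_le _⟩
  obtain ⟨K, a, Δ, hΔ, hK, hap⟩ := main_prop A' h0' I' I (by rw [hI, hI']; exact sdiff_subset)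
    v m₁ m₂ hv hm₂0 (by
      intro i x hx
      rw [hA'] at hx
      exact (mem_filter.1 hx).2) (by
      intro i hi
      rw [hI'] at hi
      have h1 := (mem_filter.1 hi).2
      rw [← hvd] at h1
      rw [hA']
      change m₁ + 1 ≤ #((A i).filter (fun x => x ≤ v))
      rw [cnt_filter (A i) (h0 i) v]
      have h2 := hal k
      have h3 : (n : ℝ) ≤ 2 * cnt (A i) v := by nlinarith
      have h4 : n ≤ 2 * cnt (A i) v := by exact_mod_cast h3
      omega) (by
      intro i hi
      rw [hI, mem_sdiff] at hi
      have h1 := (mem_filter.1 hi.1).2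
      have h2 : ¬ ((n : ℝ) * al (k + 1) ≤ cnt (A i) (u / 2 ^ (k + 1))) := fun h =>
        hi.2 (mem_filter.2 ⟨mem_univ _, h⟩)
      push Not at h2
      rw [← hvd] at h1
      rw [hv2] at h2
      have h3 := cnt_split (A i) v (v / 2)
      have h4 : (A' i).filter (fun x => v / 2 < x)
          = (A i).filter (fun x => v / 2 < x ∧ x ≤ v) := by
        rw [hA']
        ext x
        simp only [mem_filter]
        tauto
      rw [h4, hm₂]
      apply Nat.ceil_le.2
      have h5 : (cnt (A i) v : ℝ) ≤ cnt (A i) (v / 2)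
          + #((A i).filter (fun x => v / 2 < x ∧ x ≤ v)) := by exact_mod_cast h3
      rw [← hdiff]
      linarith) (by
      have h1 : ((l : ℝ) * (q / 20)) * ((n : ℝ) * (q / 20)) ≤ #I * m₂ :=
        mul_le_mul hIc hm₂R (by positivity) (by positivity)
      have h2 : (1600000000 : ℝ) * u ≤ l * n := by exact_mod_cast hc
      have h3 : (2 : ℝ) ^ k * v ≤ u := by exact_mod_cast hvu
      have h4 : (1 : ℝ) ≤ q ^ 2 * 2 ^ k := by
        rw [hq, ← pow_mul, mul_comm k 2, pow_mul, ← mul_pow]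
        apply one_le_pow₀
        norm_num
      have h5 : (v : ℝ) ≤ q ^ 2 * u := by
        calc (v : ℝ) = 1 * v := by ring
          _ ≤ (q ^ 2 * 2 ^ k) * v := by gcongr
          _ = q ^ 2 * (2 ^ k * v) := by ring
          _ ≤ q ^ 2 * u := by gcongr
      have h6 : q ^ 2 * (1600000000 * u) ≤ q ^ 2 * (l * n) := by gcongr
      have h7 : (4000000 : ℝ) * v ≤ #I * m₂ := by nlinarith
      exact_mod_cast h7)
  refine ⟨K, a, Δ, hΔ, ?_, ?_⟩
  · have h1 : (l : ℝ) ≤ 2 * #I' := by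
      rw [hI']
      have := hal k
      nlinarith
    have h1 : l ≤ 2 * #I' := by exact_mod_cast h1
    have h2 : n ≤ 2 * m₁ := by omega
    have h3 : l * n ≤ (2 * #I') * (2 * m₁) := Nat.mul_le_mul h1 h2
    have h4 : (2 * #I') * (2 * m₁) = 4 * (#I' * m₁) := by ring
    omega
  · intro j hj
    apply Sm_subset A' A (fun i => by rw [hA']; exact filter_subset _ _)
    exact Sm_mono A' h0' (subset_univ I') (hap j hj)

lemma translate_mem {ι : Type*} (A B : ι → Finset ℕ) (s : ι → ℕ)
    (h : ∀ i, ∀ x ∈ B i, s i + x ∈ A i) (J : Finset ι) :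
    ∀ x ∈ Sm B J, ∑ i ∈ J, s i + x ∈ Sm A J := by
  classical
  unfold Sm
  induction J using Finset.induction_on with
  | empty => simp
  | insert i J hi ih =>
    rw [sum_insert hi, sum_insert hi, sum_insert hi]
    intro x hx
    obtain ⟨y, hy, z, hz, rfl⟩ := mem_add.1 hx
    have e : s i + ∑ i ∈ J, s i + (y + z) = (s i + y) + (∑ i ∈ J, s i + z) := by ring
    rw [e]
    exact add_mem_add (h i y hy) (ih z hz)

end SumAP

/-- There exists a sufficiently large constant `c` such that: if `A₁, …, A_ℓ` are subsets of
`[0, u]`, each of size at least `m`, and `ℓ · (m − 1) ≥ c · u`, then `A₁ + ⋯ + A_ℓ` contains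
an arithmetic progression of length at least `u`. -/
theorem stmt1 :
    ∃ c : ℝ, 0 < c ∧
      ∀ (u ℓ m : ℕ), 0 < u → 0 < ℓ → 0 < m →
        ∀ A : Fin ℓ → Finset ℕ,
          (∀ i, A i ⊆ Finset.Icc 0 u) →
          (∀ i, m ≤ (A i).card) →
          c * u ≤ (ℓ : ℝ) * ((m : ℝ) - 1) →
          ∃ (k : ℕ) (a Δ : ℕ), 0 < Δ ∧ u ≤ k ∧
            ∀ j < k, a + j * Δ ∈ ∑ i, A i := by
  refine ⟨1600000000, by norm_num, ?_⟩
  intro u l m hu hl hm A hA hcard hc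
  obtain ⟨n, rfl⟩ : ∃ n, m = n + 1 := ⟨m - 1, by omega⟩
  have hc' : 1600000000 * u ≤ l * n := by
    push_cast at hc
    rw [add_sub_cancel_right] at hc
    exact_mod_cast hc
  have hne : ∀ i, (A i).Nonempty := by
    intro i
    rw [← card_pos]
    have := hcard i
    omega
  obtain ⟨s, hs⟩ : ∃ s : Fin l → ℕ, s = fun i => (A i).min' (hne i) := ⟨_, rfl⟩
  have hsmem : ∀ i, s i ∈ A i := by
    intro i
    rw [hs]
    exact min'_mem _ _
  have hsle : ∀ i, ∀ x ∈ A i, s i ≤ x := by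
    intro i x hx
    rw [hs]
    exact min'_le _ _ hx
  obtain ⟨B, hB⟩ : ∃ B : Fin l → Finset ℕ, B = fun i => (A i).image (fun x => x - s i) :=
    ⟨_, rfl⟩
  obtain ⟨k, a, Δ, hΔ, hk, hap⟩ := SumAP.reduce u l n hu B (by
    intro i
    rw [hB]
    exact mem_image.2 ⟨s i, hsmem i, Nat.sub_self _⟩) (by
    intro i x hx
    rw [hB] at hx
    obtain ⟨y, hy, rfl⟩ := mem_image.1 hx
    have := mem_Icc.1 (hA i hy)
    omega) (by
    intro i
    rw [hB]
    change n + 1 ≤ #((A i).image (fun x => x - s i))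
    rw [card_image_of_injOn]
    · exact hcard i
    · intro x hx y hy hxy
      have h1 := hsle i x hx
      have h2 := hsle i y hy
      simp only at hxy
      omega) hc'
  refine ⟨k, ∑ i, s i + a, Δ, hΔ, hk, ?_⟩
  intro j hj
  have h1 := SumAP.translate_mem A B s (by
    intro i x hx
    rw [hB] at hx
    obtain ⟨y, hy, rfl⟩ := mem_image.1 hx
    have := hsle i y hy
    rwa [Nat.add_sub_cancel' this]) univ _ (hap j hj)
  rw [add_assoc]
  exact h1
end

section
/- There exists a constant c ≥ 1 such that the following holds. Let u, γ, ℓ be positive integers and let A₁, …, A_ℓ be subsets of [0, u] with 0 ∈ A_i for every i ∈ [1, ℓ]. Let S = A₁ + ⋯ + A_ℓ and η = max(A₁) + ⋯ + max(A_ℓ). If for some k ∈ [2, u+1] at least c·γ·u/(k−1) of the sets A₁, …, A_ℓ have size at least k, then S contains a finite increasing sequence s₁ < s₂ < … < s_m such that s₁ ≤ 2η/γ, s_m ≥ (γ−2)η/γ, and s_i − s_{i−1} ≤ 4ℓ/γ for every i ∈ [2, m]. -/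
open Pointwise Finset

namespace LowGap

/-- number of elements of `A` in `[1,x]`. -/
def cnt (A : Finset ℕ) (x : ℕ) : ℕ := (A ∩ Finset.Icc 1 x).card

lemma cnt_succ_mem {A : Finset ℕ} {x : ℕ} (h : x + 1 ∈ A) : cnt A (x + 1) = cnt A x + 1 := by
  unfold cnt
  have : A ∩ Finset.Icc 1 (x + 1) = insert (x + 1) (A ∩ Finset.Icc 1 x) := by
    ext y
    simp only [Finset.mem_inter, Finset.mem_Icc, Finset.mem_insert]
    constructor
    · rintro ⟨h1, h2, h3⟩
      by_cases hy : y = x + 1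
      · exact Or.inl hy
      · exact Or.inr ⟨h1, h2, by omega⟩
    · rintro (rfl | ⟨h1, h2, h3⟩)
      · exact ⟨h, by omega, le_refl _⟩
      · exact ⟨h1, h2, by omega⟩
  rw [this, Finset.card_insert_of_notMem]
  simp

/-- Schnirelmann's counting inequality. -/
lemma sch_aux (A B : Finset ℕ) (hA : 0 ∈ A) (hB : 0 ∈ B) (u : ℕ) (β : ℝ)
    (hb : ∀ x ≤ u, β * x ≤ cnt B x) :
    ∀ x ≤ u, (cnt A x : ℝ) + β * (x - cnt A x) ≤ cnt (A + B) x := by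
  intro x
  induction x using Nat.strong_induction_on with
  | _ x ih =>
  intro hx
  by_cases hxA : x ∈ A
  · rcases x with _ | x
    · simp [cnt]
    · have h1 := ih x (by omega) (by omega)
      have hm : x + 1 ∈ A + B := by
        have := Finset.add_mem_add hxA hB
        simpa using this
      rw [cnt_succ_mem hxA, cnt_succ_mem hm]
      push_cast
      linarith
  · have hne : (A.filter (· ≤ x)).Nonempty := ⟨0, by simp [hA]⟩
    set a := (A.filter (· ≤ x)).max' hne with ha
    have hmem : a ∈ A.filter (· ≤ x) := Finset.max'_mem _ hne
    have haA : a ∈ A := (Finset.mem_filter.1 hmem).1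
    have hax : a ≤ x := (Finset.mem_filter.1 hmem).2
    have hlt : a < x := lt_of_le_of_ne hax (fun h => hxA (h ▸ haA))
    have hmax : ∀ y ∈ A, y ≤ x → y ≤ a := fun y hy hyx =>
      Finset.le_max' _ _ (Finset.mem_filter.2 ⟨hy, hyx⟩)
    have h1 := ih a hlt (by omega)
    have h2 : cnt A x = cnt A a := by
      unfold cnt
      congr 1
      ext y
      simp only [Finset.mem_inter, Finset.mem_Icc]
      constructor
      · rintro ⟨h1, h2, h3⟩
        exact ⟨h1, h2, hmax y h1 h3⟩
      · rintro ⟨h1, h2, h3⟩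
        exact ⟨h1, h2, by omega⟩
    have h3 : cnt (A + B) a + cnt B (x - a) ≤ cnt (A + B) x := by
      unfold cnt
      have e : ((B ∩ Finset.Icc 1 (x - a)).image (a + ·)).card
          = (B ∩ Finset.Icc 1 (x - a)).card :=
        Finset.card_image_of_injective _ (add_right_injective a)
      rw [← e, ← Finset.card_union_of_disjoint]
      · apply Finset.card_le_card
        intro y hy
        simp only [Finset.mem_union, Finset.mem_inter, Finset.mem_Icc, Finset.mem_image] at hy ⊢
        rcases hy with ⟨h1, h2, h3⟩ | ⟨b, ⟨hb1, hb2, hb3⟩, rfl⟩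
        · exact ⟨h1, h2, by omega⟩
        · exact ⟨Finset.add_mem_add haA hb1, by omega, by omega⟩
      · rw [Finset.disjoint_left]
        intro y hy hy2
        simp only [Finset.mem_inter, Finset.mem_Icc, Finset.mem_image] at hy hy2
        obtain ⟨b, ⟨hb1, hb2, hb3⟩, rfl⟩ := hy2
        omega
    have h4 := hb (x - a) (by omega)
    rw [Nat.cast_sub hax] at h4
    have h3' : (cnt (A + B) a : ℝ) + cnt B (x - a) ≤ cnt (A + B) x := by exact_mod_cast h3
    rw [h2]
    linarith

lemma zero_mem_sum {ι : Type*} (J : Finset ι) (D : ι → Finset ℕ) (h0 : ∀ i ∈ J, 0 ∈ D i) :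
    0 ∈ ∑ i ∈ J, D i := by
  classical
  induction J using Finset.induction_on with
  | empty => simp
  | insert j J hj ih =>
    rw [Finset.sum_insert hj]
    have := Finset.add_mem_add (h0 j (Finset.mem_insert_self _ _))
      (ih (fun i hi => h0 i (Finset.mem_insert_of_mem hi)))
    simpa using this

lemma sch_sum {ι : Type*} [DecidableEq ι] (u : ℕ) (δ : ℝ) (hδ1 : δ ≤ 1)
    (D : ι → Finset ℕ) (J : Finset ι) (h0 : ∀ i ∈ J, 0 ∈ D i)
    (hd : ∀ i ∈ J, ∀ x ≤ u, δ * x ≤ cnt (D i) x) :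
    ∀ x ≤ u, (1 - (1 - δ) ^ J.card) * x ≤ cnt (∑ i ∈ J, D i) x := by
  induction J using Finset.induction_on with
  | empty => intro x _; simp
  | insert j J hj ih =>
    intro x hx
    have ih' := ih (fun i hi => h0 i (Finset.mem_insert_of_mem hi))
      (fun i hi => hd i (Finset.mem_insert_of_mem hi))
    rw [Finset.sum_insert hj, Finset.card_insert_of_notMem hj]
    have h1 := sch_aux (D j) (∑ i ∈ J, D i) (h0 j (Finset.mem_insert_self _ _))
      (zero_mem_sum J D (fun i hi => h0 i (Finset.mem_insert_of_mem hi))) u _ ih' x hx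
    have h2 := hd j (Finset.mem_insert_self _ _) x hx
    have h3 : 0 ≤ (1 - δ) ^ J.card := pow_nonneg (by linarith) _
    have h4 := mul_le_mul_of_nonneg_left h2 h3
    rw [pow_succ]
    nlinarith

lemma pigeon (A B : Finset ℕ) (hA : 0 ∈ A) (hB : 0 ∈ B) (x : ℕ)
    (h : x ≤ cnt A x + cnt B x) : x ∈ A + B := by
  by_cases hxA : x ∈ A
  · simpa using Finset.add_mem_add hxA hB
  by_cases hxB : x ∈ B
  · simpa using Finset.add_mem_add hA hxB
  have hx0 : x ≠ 0 := fun h => hxA (h ▸ hA)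
  have hB' : ((B ∩ Finset.Icc 1 x).image (x - ·)).card = (B ∩ Finset.Icc 1 x).card := by
    apply Finset.card_image_of_injOn
    intro y hy z hz hyz
    simp at hy hz hyz
    omega
  have hnd : ¬ Disjoint (A ∩ Finset.Icc 1 x) ((B ∩ Finset.Icc 1 x).image (x - ·)) := by
    intro hdis
    have h1 := Finset.card_union_of_disjoint hdis
    rw [hB'] at h1
    have h2 : (A ∩ Finset.Icc 1 x) ∪ ((B ∩ Finset.Icc 1 x).image (x - ·)) ⊆ Finset.Icc 1 (x - 1) := by
      intro y hy
      simp only [Finset.mem_union, Finset.mem_inter, Finset.mem_Icc, Finset.mem_image] at hy ⊢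
      rcases hy with ⟨h1, h2, h3⟩ | ⟨b, ⟨hb1, hb2, hb3⟩, rfl⟩
      · have : y ≠ x := fun h => hxA (h ▸ h1)
        omega
      · have : b ≠ x := fun h => hxB (h ▸ hb1)
        omega
    have h3 := Finset.card_le_card h2
    simp only [Nat.card_Icc] at h3
    unfold cnt at h
    omega
  rw [Finset.not_disjoint_iff] at hnd
  obtain ⟨y, hy, hy2⟩ := hnd
  simp only [Finset.mem_inter, Finset.mem_Icc, Finset.mem_image] at hy hy2
  obtain ⟨b, ⟨hb1, hb2, hb3⟩, hb4⟩ := hy2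
  have := Finset.add_mem_add hy.1 hb1
  have e : y + b = x := by omega
  rwa [e] at this

/-- A rising sun argument. -/
lemma rising (A : Finset ℕ) (u k : ℕ) (hu : 0 < u) (hsub : A ⊆ Finset.Icc 0 u)
    (hk : k ≤ A.card) (hk0 : 0 < k) :
    ∃ a ∈ A, ∀ x, 1 ≤ x → x ≤ u → k * x ≤ (A ∩ Finset.Ico a (a + x)).card * (2 * u) := by
  by_contra hcon
  push Not at hcon
  have key : ∀ d y, y + d = 2 * u → (∃ z ∈ A, y ≤ z) →
      (A.filter (y ≤ ·)).card * (2 * u) < k * d := by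
    intro d
    induction d using Nat.strong_induction_on with
    | _ d ih =>
    intro y hyd hne
    have hne' : (A.filter (y ≤ ·)).Nonempty := by
      obtain ⟨z, h1, h2⟩ := hne
      exact ⟨z, by simp [h1, h2]⟩
    set a := (A.filter (y ≤ ·)).min' hne' with ha
    have hmem : a ∈ A.filter (y ≤ ·) := Finset.min'_mem _ hne'
    have haA : a ∈ A := (Finset.mem_filter.1 hmem).1
    have hya : y ≤ a := (Finset.mem_filter.1 hmem).2
    have hmin : ∀ z ∈ A, y ≤ z → a ≤ z := fun z hz hyz =>
      Finset.min'_le _ _ (Finset.mem_filter.2 ⟨hz, hyz⟩)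
    have hau : a ≤ u := (Finset.mem_Icc.1 (hsub haA)).2
    obtain ⟨x, hx1, hx2, hx3⟩ := hcon a haA
    have hsplit : (A.filter (y ≤ ·)).card ≤
        (A ∩ Finset.Ico a (a + x)).card + (A.filter (a + x ≤ ·)).card := by
      refine le_trans (Finset.card_le_card ?_) (Finset.card_union_le _ _)
      intro z hz
      simp only [Finset.mem_filter, Finset.mem_union, Finset.mem_inter, Finset.mem_Ico] at hz ⊢
      have := hmin z hz.1 hz.2
      by_cases h : a + x ≤ z
      · exact Or.inr ⟨hz.1, h⟩
      · exact Or.inl ⟨hz.1, this, by omega⟩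
    have hrest : (A.filter (a + x ≤ ·)).card * (2 * u) ≤ k * (2 * u - (a + x)) := by
      by_cases h : ∃ z ∈ A, a + x ≤ z
      · exact (ih (2 * u - (a + x)) (by omega) (a + x) (by omega) h).le
      · have : A.filter (a + x ≤ ·) = ∅ := by
          rw [Finset.filter_eq_empty_iff]
          intro z hz hz2
          exact h ⟨z, hz, hz2⟩
        simp [this]
    calc (A.filter (y ≤ ·)).card * (2 * u)
        ≤ ((A ∩ Finset.Ico a (a + x)).card + (A.filter (a + x ≤ ·)).card) * (2 * u) :=
          Nat.mul_le_mul_right _ hsplit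
      _ < k * x + k * (2 * u - (a + x)) := by rw [add_mul]; omega
      _ = k * (x + (2 * u - (a + x))) := by ring
      _ ≤ k * d := Nat.mul_le_mul_left _ (by omega)
  have hAne : A.Nonempty := Finset.card_pos.1 (by omega)
  obtain ⟨z, hz⟩ := hAne
  have := key (2 * u) 0 (by omega) ⟨z, hz, Nat.zero_le _⟩
  rw [Finset.filter_true_of_mem (fun _ _ => Nat.zero_le _)] at this
  have h2 := Nat.mul_le_mul_right (2 * u) hk
  omega

lemma dense (A : Finset ℕ) (u k : ℕ) (hu : 0 < u) (hsub : A ⊆ Finset.Icc 0 u)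
    (hk : k ≤ A.card) (hk0 : 0 < k) :
    ∃ a ∈ A, ∃ D : Finset ℕ, 0 ∈ D ∧ (∀ d ∈ D, ∃ e ∈ A, e ≤ d + a ∧ d + a ≤ e + 1) ∧
      ∀ x ≤ u, k * x ≤ 4 * u * cnt D x := by
  obtain ⟨a, haA, ha⟩ := rising A u k hu hsub hk hk0
  refine ⟨a, haA, insert 1 ((A.filter (a ≤ ·)).image (· - a)), ?_, ?_, ?_⟩
  · simp only [Finset.mem_insert, Finset.mem_image, Finset.mem_filter]
    exact Or.inr ⟨a, ⟨haA, le_refl _⟩, by omega⟩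
  · intro d hd
    simp only [Finset.mem_insert, Finset.mem_image, Finset.mem_filter] at hd
    rcases hd with rfl | ⟨e, ⟨he, hae⟩, rfl⟩
    · exact ⟨a, haA, by omega, by omega⟩
    · exact ⟨e, he, by omega, by omega⟩
  · intro x hx
    rcases Nat.eq_zero_or_pos x with rfl | hx0
    · simp
    set D := insert 1 ((A.filter (a ≤ ·)).image (· - a)) with hD
    have h1 : 1 ≤ cnt D x := by
      unfold cnt
      apply Finset.card_pos.2
      exact ⟨1, by simp [hD]; omega⟩
    have h2 : (A ∩ Finset.Ico a (a + x)).card ≤ cnt D x + 1 := by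
      have e : ((A ∩ Finset.Ico a (a + x)).image (· - a)).card = (A ∩ Finset.Ico a (a + x)).card := by
        apply Finset.card_image_of_injOn
        intro y hy z hz hyz
        simp at hy hz hyz
        omega
      rw [← e]
      unfold cnt
      refine le_trans (Finset.card_le_card ?_) (Finset.card_insert_le 0 _)
      intro y hy
      simp only [hD, Finset.mem_insert, Finset.mem_inter, Finset.mem_Icc, Finset.mem_image,
        Finset.mem_filter, Finset.mem_Ico] at hy ⊢
      obtain ⟨z, ⟨hz1, hz2, hz3⟩, rfl⟩ := hy
      by_cases h : z - a = 0
      · exact Or.inl h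
      · exact Or.inr ⟨Or.inr ⟨z, ⟨hz1, hz2⟩, rfl⟩, by omega, by omega⟩
    have h3 := ha x hx0 hx
    have h4 : k * x ≤ (cnt D x + 1) * (2 * u) := le_trans h3 (Nat.mul_le_mul_right _ h2)
    nlinarith

lemma lift_sum {ι : Type*} [DecidableEq ι] (J : Finset ι) (A D : ι → Finset ℕ) (a : ι → ℕ)
    (h : ∀ i ∈ J, ∀ d ∈ D i, ∃ e ∈ A i, e ≤ d + a i ∧ d + a i ≤ e + 1) :
    ∀ z ∈ ∑ i ∈ J, D i, ∃ t ∈ ∑ i ∈ J, A i,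
      t ≤ z + ∑ i ∈ J, a i ∧ z + ∑ i ∈ J, a i ≤ t + J.card := by
  induction J using Finset.induction_on with
  | empty => intro z hz; simpa using hz
  | insert j J hj ih =>
    intro z hz
    rw [Finset.sum_insert hj] at hz ⊢
    rw [Finset.sum_insert hj, Finset.card_insert_of_notMem hj]
    obtain ⟨d, hd, z', hz', rfl⟩ := Finset.mem_add.1 hz
    obtain ⟨e, he, he1, he2⟩ := h j (Finset.mem_insert_self _ _) d hd
    obtain ⟨t, ht, ht1, ht2⟩ := ih (fun i hi => h i (Finset.mem_insert_of_mem hi)) z' hz'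
    exact ⟨e + t, Finset.add_mem_add he ht, by omega, by omega⟩

lemma pow_half (δ : ℝ) (hδ1 : δ ≤ 1) (q : ℕ) (hq : 1 ≤ q * δ) : (1 - δ) ^ q ≤ 1 / 2 := by
  have h1 : (1 - δ) ≤ Real.exp (-δ) := by
    have := Real.add_one_le_exp (-δ); linarith
  have h2 : (1 - δ) ^ q ≤ Real.exp (-δ) ^ q := pow_le_pow_left₀ (by linarith) h1 q
  rw [← Real.exp_nat_mul] at h2
  have h3 : Real.exp (q * -δ) ≤ Real.exp (-1) := Real.exp_le_exp.2 (by linarith)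
  have h4 : Real.exp (-1) ≤ 1 / 2 := by
    rw [Real.exp_neg, one_div]
    apply inv_anti₀ (by norm_num)
    have := Real.add_one_le_exp (1 : ℝ); linarith
  linarith

lemma core {ι : Type*} [DecidableEq ι] (J : Finset ι) (A : ι → Finset ℕ) (u k q : ℕ)
    (hu : 0 < u) (hk0 : 0 < k) (hku : k ≤ u + 1) (hsub : ∀ i, A i ⊆ Finset.Icc 0 u)
    (hk : ∀ i ∈ J, k ≤ (A i).card) (hJ : J.card = 2 * q) (hq : 4 * u ≤ q * k) :
    ∃ a : ι → ℕ, (∀ i ∈ J, a i ∈ A i) ∧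
      ∀ z ≤ u, ∃ t ∈ ∑ i ∈ J, A i,
        t ≤ z + ∑ i ∈ J, a i ∧ z + ∑ i ∈ J, a i ≤ t + J.card := by
  have hch : ∀ i, ∃ a : ℕ, ∃ D : Finset ℕ, i ∈ J → (a ∈ A i ∧ 0 ∈ D ∧
      (∀ d ∈ D, ∃ e ∈ A i, e ≤ d + a ∧ d + a ≤ e + 1) ∧
      ∀ x ≤ u, k * x ≤ 4 * u * cnt D x) := by
    intro i
    by_cases hi : i ∈ J
    · obtain ⟨a, h1, D, h2⟩ := dense (A i) u k hu (hsub i) (hk i hi) hk0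
      exact ⟨a, D, fun _ => ⟨h1, h2⟩⟩
    · exact ⟨0, ∅, fun h => absurd h hi⟩
  choose a D hD using hch
  refine ⟨a, fun i hi => (hD i hi).1, ?_⟩
  intro z hz
  apply lift_sum J A D a (fun i hi => (hD i hi).2.2.1)
  obtain ⟨J1, hJ1, hc1⟩ := Finset.exists_subset_card_eq (s := J) (n := q) (by omega)
  have hc2 : (J \ J1).card = q := by
    rw [Finset.card_sdiff_of_subset hJ1]; omega
  rw [← Finset.sum_sdiff hJ1]
  have hu' : (0 : ℝ) < u := by exact_mod_cast hu
  have hδ1 : (k : ℝ) / (4 * u) ≤ 1 := by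
    rw [div_le_one (by positivity)]
    have : k ≤ 4 * u := by omega
    exact_mod_cast this
  have hqδ : 1 ≤ (q : ℝ) * ((k : ℝ) / (4 * u)) := by
    rw [← mul_div_assoc, one_le_div (by positivity)]
    exact_mod_cast hq
  have hp := pow_half _ hδ1 q hqδ
  have hhalf : ∀ K ⊆ J, K.card = q → (z : ℝ) / 2 ≤ cnt (∑ i ∈ K, D i) z := by
    intro K hK hKq
    have := sch_sum u ((k : ℝ) / (4 * u)) hδ1 D K (fun i hi => (hD i (hK hi)).2.1)
      (fun i hi x hx => by
        have h := (hD i (hK hi)).2.2.2 x hx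
        have h' : (k : ℝ) * x ≤ 4 * u * cnt (D i) x := by exact_mod_cast h
        rw [div_mul_eq_mul_div, div_le_iff₀ (by positivity)]
        linarith) z hz
    rw [hKq] at this
    have hz0 : (0 : ℝ) ≤ z := Nat.cast_nonneg _
    nlinarith
  apply pigeon
  · exact zero_mem_sum _ _ (fun i hi => (hD i (Finset.sdiff_subset hi)).2.1)
  · exact zero_mem_sum _ _ (fun i hi => (hD i (hJ1 hi)).2.1)
  · have h1 := hhalf _ Finset.sdiff_subset hc2
    have h2 := hhalf _ hJ1 hc1
    have : (z : ℝ) ≤ cnt (∑ i ∈ J \ J1, D i) z + cnt (∑ i ∈ J1, D i) z := by linarith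
    exact_mod_cast this

lemma extend {ι : Type*} [DecidableEq ι] (K : Finset ι) (A : ι → Finset ℕ) (M : ι → ℕ)
    (u n lo hi : ℕ) (T : Finset ℕ) (h0 : ∀ i, 0 ∈ A i) (hM : ∀ i, M i ∈ A i) (hMu : ∀ i, M i ≤ u)
    (hlh : lo + u ≤ hi) (hT : ∀ z, lo ≤ z → z ≤ hi → ∃ t ∈ T, t ≤ z ∧ z ≤ t + n) :
    ∀ z, lo ≤ z → z ≤ hi + ∑ i ∈ K, M i → ∃ t ∈ (∑ i ∈ K, A i) + T, t ≤ z ∧ z ≤ t + n := by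
  induction K using Finset.induction_on with
  | empty => simpa using hT
  | insert j K hj ih =>
    intro z hz1 hz2
    rw [Finset.sum_insert hj] at hz2 ⊢
    rw [add_assoc]
    have := hMu j
    by_cases hz : z ≤ hi + ∑ i ∈ K, M i
    · obtain ⟨t, ht, h⟩ := ih z hz1 hz
      exact ⟨t, by simpa using Finset.add_mem_add (h0 j) ht, h⟩
    · obtain ⟨t, ht, h1, h2⟩ := ih (z - M j) (by omega) (by omega)
      exact ⟨M j + t, Finset.add_mem_add (hM j) ht, by omega, by omega⟩

lemma mkseq (S : Finset ℕ) (n lo : ℕ) (d : ℕ)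
    (hS : ∀ z, lo ≤ z → z ≤ lo + d → ∃ t ∈ S, t ≤ z ∧ z ≤ t + n) :
    ∃ (m : ℕ) (s : ℕ → ℕ), (∀ i < m, s i < s (i + 1) ∧ s (i + 1) ≤ s i + (n + 1)) ∧
      (∀ i ≤ m, s i ∈ S) ∧ s 0 ≤ lo ∧ s m ≤ lo + d ∧ lo + d ≤ s m + n := by
  induction d with
  | zero =>
    obtain ⟨t, ht, h1, h2⟩ := hS lo le_rfl (by omega)
    exact ⟨0, fun _ => t, by simp, by simp [ht], h1, by omega, by omega⟩
  | succ d ih =>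
    obtain ⟨m, s, h1, h2, h3, h4, h5⟩ := ih (fun z hz hz' => hS z hz (by omega))
    obtain ⟨t, ht, ht1, ht2⟩ := hS (lo + (d + 1)) (by omega) le_rfl
    by_cases h : t ≤ s m
    · exact ⟨m, s, h1, h2, h3, by omega, by omega⟩
    · refine ⟨m + 1, fun i => if i ≤ m then s i else t, ?_, ?_, ?_, ?_, ?_⟩
      · intro i hi
        by_cases him : i < m
        · have e1 : i ≤ m := by omega
          have e2 : i + 1 ≤ m := by omega
          simp only [e1, e2, if_true]
          exact h1 i him
        · have e : i = m := by omega
          subst e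
          simp
          omega
      · intro i hi
        by_cases him : i ≤ m
        · simp only [him, if_true]; exact h2 i him
        · simp only [him, if_false]; exact ht
      · simpa using h3
      · simp; omega
      · simp; omega

/-- choosing a light group. -/
lemma group {ι : Type*} [DecidableEq ι] (F : Finset ι) (M : ι → ℕ) (γ n : ℕ) (hγ : 0 < γ)
    (hF : γ * n ≤ F.card) :
    ∃ J ⊆ F, J.card = n ∧ γ * ∑ i ∈ J, M i ≤ ∑ i ∈ F, M i := by
  induction γ, hγ using Nat.le_induction generalizing F with
  | base =>
    obtain ⟨J, hJ, hc⟩ := Finset.exists_subset_card_eq (s := F) (n := n) (by omega)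
    exact ⟨J, hJ, hc, by simpa using Finset.sum_le_sum_of_subset hJ⟩
  | succ γ hγ ih =>
    have e : (γ + 1) * n = γ * n + n := by ring
    obtain ⟨J, hJ, hc⟩ := Finset.exists_subset_card_eq (s := F) (n := n)
      (by nlinarith)
    obtain ⟨J', hJ', hc', hs⟩ := ih (F \ J) (by
      rw [Finset.card_sdiff_of_subset hJ]; omega)
    have hsum := Finset.sum_sdiff (f := M) hJ
    by_cases h : ∑ i ∈ J, M i ≤ ∑ i ∈ J', M i
    · refine ⟨J, hJ, hc, ?_⟩
      nlinarith
    · refine ⟨J', hJ'.trans Finset.sdiff_subset, hc', ?_⟩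
      nlinarith

end LowGap

/-- **Dense collections yield long low-gap sequences.** There is a constant `c ≥ 1` such that:
if `A₁, …, A_ℓ` are subsets of `[0, u]` each containing `0`, `S = A₁ + ⋯ + A_ℓ`,
`η = max(A₁) + ⋯ + max(A_ℓ)`, and for some `k ∈ [2, u+1]` at least `c·γ·u/(k−1)` of the sets
have size at least `k` (γ-density), then `S` contains an increasing sequence `s₁ < ⋯ < s_m` with
`s₁ ≤ 2η/γ`, `s_m ≥ (γ−2)η/γ`, and gaps at most `4ℓ/γ`. -/
theorem stmt3 :
    ∃ c : ℝ, 1 ≤ c ∧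
      ∀ (u γ ℓ : ℕ), 0 < u → 0 < γ → 0 < ℓ →
        ∀ A : Fin ℓ → Finset ℕ,
        ∀ _hsub : ∀ i, A i ⊆ Finset.Icc 0 u,
        ∀ h0 : ∀ i, 0 ∈ A i,
        ∀ η : ℕ, η = (∑ i, (A i).max' ⟨0, h0 i⟩) →
          (∃ k : ℕ, 2 ≤ k ∧ k ≤ u + 1 ∧
            c * γ * u / ((k : ℝ) - 1) ≤
              ((Finset.univ.filter fun i => k ≤ (A i).card).card : ℝ)) →
          ∃ (m : ℕ) (s : Fin (m + 1) → ℕ),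
            StrictMono s ∧
            (∀ i, s i ∈ ∑ i, A i) ∧
            ((s 0 : ℝ) ≤ 2 * η / γ) ∧
            ((γ : ℝ) - 2) * η / γ ≤ (s (Fin.last m) : ℝ) ∧
            (∀ i : Fin m, (s i.succ : ℝ) - (s i.castSucc : ℝ) ≤ 4 * ℓ / γ) := by
  classical
  refine ⟨12, by norm_num, ?_⟩
  intro u γ ℓ hu hγ hℓ A hsub h0 η hη hk
  obtain ⟨k, hk2, hku, hk⟩ := hk
  set M : Fin ℓ → ℕ := fun i => (A i).max' ⟨0, h0 i⟩ with hM
  have hMA : ∀ i, M i ∈ A i := fun i => Finset.max'_mem _ _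
  have hMmax : ∀ i, ∀ y ∈ A i, y ≤ M i := fun i y hy => Finset.le_max' _ _ hy
  have hMu : ∀ i, M i ≤ u := fun i => (Finset.mem_Icc.1 (hsub i (hMA i))).2
  set F : Finset (Fin ℓ) := Finset.univ.filter fun i => k ≤ (A i).card with hF
  -- number of sets used
  set q : ℕ := 4 * u / k + 1 with hq
  have hq1 : 4 * u ≤ q * k := by
    have h1 := Nat.div_add_mod (4 * u) k
    have h2 := Nat.mod_lt (4 * u) (show k > 0 by omega)
    rw [hq]
    nlinarith
  have hq2 : 2 * q * (k - 1) ≤ 12 * u := by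
    have h1 := Nat.div_mul_le_self (4 * u) k
    obtain ⟨k', rfl⟩ : ∃ k', k = k' + 1 := ⟨k - 1, by omega⟩
    simp only [Nat.add_sub_cancel]
    rw [hq]
    nlinarith
  have hFc : γ * (2 * q) ≤ F.card := by
    have hk1 : (0 : ℝ) < (k : ℝ) - 1 := by
      have : (2 : ℝ) ≤ k := by exact_mod_cast hk2
      linarith
    rw [div_le_iff₀ hk1] at hk
    have hq3 : 2 * (q : ℝ) * ((k : ℝ) - 1) ≤ 12 * u := by
      have : ((2 * q * (k - 1) : ℕ) : ℝ) ≤ ((12 * u : ℕ) : ℝ) := by exact_mod_cast hq2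
      rw [Nat.cast_mul, Nat.cast_sub (by omega)] at this
      push_cast at this
      exact this
    have h3 : ((γ : ℝ) * (2 * q)) * ((k : ℝ) - 1) ≤ F.card * ((k : ℝ) - 1) := by
      refine le_trans ?_ hk
      have := mul_le_mul_of_nonneg_left hq3 (Nat.cast_nonneg (α := ℝ) γ)
      nlinarith
    have h4 := le_of_mul_le_mul_right h3 hk1
    exact_mod_cast h4
  obtain ⟨J, hJF, hJc, hJs⟩ := LowGap.group F M γ (2 * q) hγ hFc
  have hFs : ∑ i ∈ F, M i ≤ η := by
    rw [hη]; exact Finset.sum_le_sum_of_subset (Finset.subset_univ _)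
  have hF1 : F.card ≤ ∑ i ∈ F, M i := by
    rw [Finset.card_eq_sum_ones]
    apply Finset.sum_le_sum
    intro i hi
    by_contra hcon
    have hM0 : M i = 0 := by omega
    have : A i ⊆ {0} := by
      intro y hy
      have := hMmax i y hy
      simp; omega
    have h1 := Finset.card_le_card this
    have h2 := (Finset.mem_filter.1 hi).2
    simp at h1
    omega
  have hFl : F.card ≤ ℓ := by
    simpa using Finset.card_le_univ F
  obtain ⟨a, haA, hcov⟩ := LowGap.core J A u k q hu (by omega) hku hsub
    (fun i hi => (Finset.mem_filter.1 (hJF hi)).2) hJc hq1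
  set lo := ∑ i ∈ J, a i with hlo
  have hloJ : lo ≤ ∑ i ∈ J, M i := Finset.sum_le_sum (fun i hi => hMmax i _ (haA i hi))
  have hext := LowGap.extend (Finset.univ \ J) A M u (2 * q) lo (lo + u) (∑ i ∈ J, A i) h0 hMA hMu
    le_rfl (by
      intro z h1 h2
      obtain ⟨t, ht, h3, h4⟩ := hcov (z - lo) (by omega)
      exact ⟨t, ht, by omega, by omega⟩)
  rw [Finset.sum_sdiff (Finset.subset_univ J)] at hext
  have hsumM : ∑ i ∈ Finset.univ \ J, M i + ∑ i ∈ J, M i = η := by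
    rw [hη]; exact Finset.sum_sdiff (Finset.subset_univ J)
  obtain ⟨m, s, hs1, hs2, hs3, hs4, hs5⟩ := LowGap.mkseq (∑ i, A i) (2 * q) lo
    (u + ∑ i ∈ Finset.univ \ J, M i) (fun z h1 h2 => hext z h1 (by omega))
  have hγ' : (0 : ℝ) < γ := by exact_mod_cast hγ
  refine ⟨m, fun i => s i, ?_, ?_, ?_, ?_, ?_⟩
  · rw [Fin.strictMono_iff_lt_succ]
    intro i
    simpa using (hs1 i i.2).1
  · intro i
    exact hs2 i (by omega)
  · rw [le_div_iff₀ hγ']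
    have : s 0 * γ ≤ 2 * η := by nlinarith
    simpa using (by exact_mod_cast this : (s 0 : ℝ) * γ ≤ 2 * η)
  · rw [div_le_iff₀ hγ']
    have h1 : η * γ ≤ s m * γ + 2 * η := by
      have h2 : η ≤ s m + 2 * q + ∑ i ∈ J, M i := by omega
      have h3 := Nat.mul_le_mul_right γ h2
      nlinarith
    have h1' : (η : ℝ) * γ ≤ s m * γ + 2 * η := by exact_mod_cast h1
    simp only [Fin.val_last]
    linarith
  · intro i
    rw [le_div_iff₀ hγ']
    have h1 := (hs1 i i.2).2
    have h1' : (s (i + 1) : ℝ) ≤ s i + (2 * q + 1) := by exact_mod_cast h1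
    have h2 : (2 * q + 1) * γ ≤ 4 * ℓ := by nlinarith
    have h2' : (2 * (q : ℝ) + 1) * γ ≤ 4 * ℓ := by exact_mod_cast h2
    simp only [Fin.val_succ, Fin.val_castSucc]
    refine le_trans (mul_le_mul_of_nonneg_right ?_ hγ'.le) h2'
    linarith
end
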